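/- arXiv:1512.01724 — 2 statements merged into one kernel-verified Lean document; each statement's English description precedes it below -/
import Mathlib

section
/- Let n ≥ 2 and let k : {1,…,n} → {2,3,…} be the constant function k(d) = l where l ≥ 5 and l ≡ 1 (mod 4). Then there exists a group homomorphism ρ : W(n,k) → ℤ/2ℤ such that ρ(s_{i,d}) = 0 and ρ(τ_i) = 1 for all i ∈ ℕ and all d ∈ {1,…,n}. In particular, ρ(s_{1,d'}^{-1} s_{1,d}) = 0 and ρ(s_{1,d'}^{-1} τ_1 s_{1,d}) = 1 for all d, d'. -/
namespace WGroup

/-- The space `Z(n,k) × ℕ`, where `Z(n,k) = C_{k(1)} × ⋯ × C_{k(n)}` is the product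
of Cantor spaces and the second factor indexes the copies.  (Indices are taken in
Lean's `ℕ`, i.e. starting from `0` rather than `1`.) -/
abbrev Sp (n : ℕ) (k : Fin n → ℕ) : Type := (∀ d : Fin n, ℕ → Fin (k d)) × ℕ

/-- The defining formula for the generator `s_{i,d}`:
`s_{i,d}(z,j) = (z,j)` for `j < i`; `s_{i,d}(z,i) = (σ_d(z), i + z^{(d)}_1)`; and
`s_{i,d}(z,j) = (z, j + k(d) - 1)` for `j > i`. -/
def sMap {n : ℕ} (k : Fin n → ℕ) (i : ℕ) (d : Fin n) (p : Sp n k) : Sp n k :=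
  if p.2 < i then p
  else if p.2 = i then
    (Function.update p.1 d (fun m => p.1 d (m + 1)), i + (p.1 d 0 : ℕ))
  else (p.1, p.2 + (k d - 1))

/-- The defining formula for the generator `τ_i`: it interchanges `(z,i)` and
`(z,i+1)` and fixes all other points. -/
def tMap {n : ℕ} (k : Fin n → ℕ) (i : ℕ) (p : Sp n k) : Sp n k :=
  if p.2 = i then (p.1, i + 1)
  else if p.2 = i + 1 then (p.1, i)
  else p

/-- The generating set `{s_{i,d}, τ_i : i ∈ ℕ, 1 ≤ d ≤ n}` of `W(n,k)`. -/
def gens {n : ℕ} (k : Fin n → ℕ) (s : ℕ → Fin n → Equiv.Perm (Sp n k))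
    (t : ℕ → Equiv.Perm (Sp n k)) : Set (Equiv.Perm (Sp n k)) :=
  {g | ∃ i d, g = s i d} ∪ {g | ∃ i, g = t i}

end WGroup

namespace WGroup

/-- The points of `Z(n,k) × ℕ` for the constant function `k = l`. -/
abbrev Pt (n l : ℕ) : Type := (Fin n → ℕ → Fin l) × ℕ

variable {n l : ℕ}

/-- The map `σ_d` shifting the `d`-th coordinate sequence. -/
def shift (d : Fin n) (z : Fin n → ℕ → Fin l) : Fin n → ℕ → Fin l :=
  Function.update z d (fun m => z d (m + 1))

@[simp] lemma shift_self (d : Fin n) (z : Fin n → ℕ → Fin l) (m : ℕ) :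
    shift d z d m = z d (m + 1) := by simp [shift]

lemma shift_of_ne {d e : Fin n} (h : e ≠ d) (z : Fin n → ℕ → Fin l) :
    shift d z e = z e := by simp [shift, h]

lemma shift_comm {d e : Fin n} (h : e ≠ d) (z : Fin n → ℕ → Fin l) :
    shift d (shift e z) = shift e (shift d z) := by
  funext c
  by_cases hd : c = d
  · subst hd; funext m; simp [shift_of_ne h.symm]
  · by_cases he : c = e
    · subst he; funext m; simp [shift_of_ne h]
    · simp [shift_of_ne hd, shift_of_ne he]

/-- `s` is the family of maps `s_{i,d}`. -/
def IsSplit (s : ℕ → Fin n → Equiv.Perm (Pt n l)) : Prop :=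
  ∀ i d z j, s i d (z, j) =
    if j < i then (z, j) else if j = i then (shift d z, i + (z d 0 : ℕ)) else (z, j + (l - 1))

/-- `t` is the family of maps `τ_i`. -/
def IsTransp (t : ℕ → Equiv.Perm (Pt n l)) : Prop :=
  ∀ i z j, t i (z, j) = if j = i then (z, i + 1) else if j = i + 1 then (z, i) else (z, j)

/-! ### Inversions -/

/-- The lexicographic order on `Z(n,k)`. -/
def zlt (x y : Fin n → ℕ → Fin l) : Prop :=
  ∃ e, (∀ e' < e, x e' = y e') ∧ ∃ m, (∀ m' < m, x e m' = y e m') ∧ x e m < y e m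

/-- Points, ordered by level first and then lexicographically. -/
def key (p : Pt n l) : ℕ ×ₗ Lex (Fin n → Lex (ℕ → Fin l)) :=
  toLex (p.2, toLex (fun d => toLex (p.1 d)))

lemma key_injective : Function.Injective (key : Pt n l → _) := by
  rintro ⟨x, i⟩ ⟨y, j⟩ h
  have h1 : (i, (fun d => toLex (x d))) = (j, (fun d => toLex (y d))) := h
  obtain ⟨h2, h3⟩ := Prod.mk.inj h1
  refine Prod.ext (funext fun d => ?_) h2
  exact congrFun h3 d

lemma key_lt (x y : Fin n → ℕ → Fin l) (i j : ℕ) :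
    key (x, i) < key (y, j) ↔ i < j ∨ i = j ∧ zlt x y := by
  unfold key
  rw [Prod.Lex.toLex_lt_toLex]
  rfl

/-- The parity of the number of inversions of `f` on the finite set `T`. -/
noncomputable def inv (T : Finset (Pt n l)) (f : Pt n l → Pt n l) : ZMod 2 :=
  ((T ×ˢ T).filter fun q => key q.1 < key q.2 ∧ key (f q.2) < key (f q.1)).card

lemma inv_eq_sum (T : Finset (Pt n l)) (f : Pt n l → Pt n l) :
    inv T f = ∑ x ∈ T, ∑ y ∈ T,
      if key x < key y ∧ key (f y) < key (f x) then (1 : ZMod 2) else 0 := by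
  simp only [inv, Finset.card_filter, Finset.sum_product, Nat.cast_sum, Nat.cast_ite,
    Nat.cast_one, Nat.cast_zero]

lemma inv_comp (T : Finset (Pt n l)) (g h : Equiv.Perm (Pt n l)) :
    inv T ⇑(h * g) = inv T g + inv (T.map g.toEmbedding) h := by
  have e1 : inv (T.map g.toEmbedding) h = ∑ x ∈ T, ∑ y ∈ T,
      if key (g x) < key (g y) ∧ key (h (g y)) < key (h (g x)) then (1 : ZMod 2) else 0 := by
    simp only [inv_eq_sum, Finset.sum_map, Equiv.coe_toEmbedding]
  have e2 : inv (T.map g.toEmbedding) h = ∑ x ∈ T, ∑ y ∈ T,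
      ((if key x < key y ∧ key (g x) < key (g y) ∧ key (h (g y)) < key (h (g x))
        then (1 : ZMod 2) else 0) +
      if key x < key y ∧ key (g y) < key (g x) ∧ key (h (g x)) < key (h (g y))
        then (1 : ZMod 2) else 0) := by
    simp_rw [Finset.sum_add_distrib]
    rw [Finset.sum_comm (f := fun x y => if key x < key y ∧ key (g y) < key (g x) ∧
      key (h (g x)) < key (h (g y)) then (1 : ZMod 2) else 0), e1]
    simp_rw [← Finset.sum_add_distrib]
    refine Finset.sum_congr rfl fun x _ => Finset.sum_congr rfl fun y _ => ?_
    rcases lt_trichotomy (key x) (key y) with hxy | hxy | hxy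
    · simp [hxy, hxy.not_gt]
    · have := key_injective hxy
      subst this
      simp
    · simp [hxy, hxy.not_gt]
  rw [e2, inv_eq_sum, inv_eq_sum, ← Finset.sum_add_distrib]
  refine Finset.sum_congr rfl fun x _ => ?_
  rw [← Finset.sum_add_distrib]
  refine Finset.sum_congr rfl fun y _ => ?_
  have hg : key x < key y → key (g x) ≠ key (g y) := fun hxy h' =>
    hxy.ne (congrArg key (g.injective (key_injective h')))
  have hh : key x < key y → key (h (g x)) ≠ key (h (g y)) := fun hxy h' =>
    hxy.ne (congrArg key (g.injective (h.injective (key_injective h'))))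
  have two : (1 + 1 : ZMod 2) = 0 := by decide
  by_cases hxy : key x < key y
  · rcases (hg hxy).lt_or_gt with h1 | h1 <;> rcases (hh hxy).lt_or_gt with h2 | h2 <;>
      simp [hxy, h1, h2, h1.not_gt, h2.not_gt, Equiv.Perm.mul_apply, two]
  · simp [hxy]

/-! ### Grids -/

variable [NeZero l]

open Classical in
/-- The sequences that vanish from position `r` on. -/
noncomputable def digits (l : ℕ) [NeZero l] : ℕ → Finset (ℕ → Fin l)
  | 0 => {fun _ => 0}
  | r + 1 => (Finset.univ ×ˢ digits l r).image
      fun q m => m.casesOn q.1 q.2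

lemma mem_digits (r : ℕ) (f : ℕ → Fin l) : f ∈ digits l r ↔ ∀ m ≥ r, f m = 0 := by
  induction r generalizing f with
  | zero => simp [digits, funext_iff]
  | succ r ih =>
    simp only [digits, Finset.mem_image, Finset.mem_product, Finset.mem_univ, true_and, ih,
      Prod.exists]
    constructor
    · rintro ⟨a, g, hg, rfl⟩ m hm
      obtain ⟨m, rfl⟩ : ∃ m', m = m' + 1 := ⟨m - 1, by omega⟩
      exact hg m (by omega)
    · intro hf
      refine ⟨f 0, fun m => f (m + 1), fun m hm => hf _ (by omega), ?_⟩
      funext m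
      cases m <;> rfl

lemma card_digits (r : ℕ) : (digits l r).card = l ^ r := by
  induction r with
  | zero => simp [digits]
  | succ r ih =>
    classical
    rw [digits, Finset.card_image_of_injective, Finset.card_product, ih]
    · simp [pow_succ, mul_comm]
    · rintro ⟨a, f⟩ ⟨b, g⟩ h
      exact Prod.ext (congrFun h 0) (funext fun m => congrFun h (m + 1))

/-- The points of level below `J` whose `d`-th coordinate vanishes from position `N j d` on,
where `j` is the level. -/
noncomputable def grid (N : ℕ → Fin n → ℕ) (J : ℕ) : Finset (Pt n l) := by
  classical exact (Finset.range J).biUnion fun j =>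
    (Fintype.piFinset fun d => digits l (N j d)) ×ˢ {j}

lemma mem_grid (N : ℕ → Fin n → ℕ) (J : ℕ) (z : Fin n → ℕ → Fin l) (j : ℕ) :
    (z, j) ∈ grid N J ↔ j < J ∧ ∀ d, ∀ m ≥ N j d, z d m = 0 := by
  simp only [grid, Finset.mem_biUnion, Finset.mem_range, Finset.mem_product,
    Fintype.mem_piFinset, mem_digits, Finset.mem_singleton]
  constructor
  · rintro ⟨j', h1, h2, rfl⟩
    exact ⟨h1, h2⟩
  · rintro ⟨h1, h2⟩
    exact ⟨j, h1, h2, rfl⟩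

lemma odd_card_level (hl : Odd l) (N : ℕ → Fin n → ℕ) {J i : ℕ} (hi : i < J) :
    Odd ((grid (l := l) N J).filter fun p => p.2 = i).card := by
  classical
  have : (grid (l := l) N J).filter (fun p => p.2 = i) =
      (Fintype.piFinset fun d => digits l (N i d)) ×ˢ {i} := by
    ext ⟨z, j⟩
    simp only [Finset.mem_filter, mem_grid, Finset.mem_product, Fintype.mem_piFinset, mem_digits,
      Finset.mem_singleton]
    constructor
    · rintro ⟨⟨_, h⟩, rfl⟩
      exact ⟨h, rfl⟩
    · rintro ⟨h, rfl⟩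
      exact ⟨⟨hi, h⟩, rfl⟩
  rw [this, Finset.card_product, Fintype.card_piFinset, Finset.card_singleton, mul_one]
  refine Finset.prod_induction _ Odd (fun _ _ => Odd.mul) odd_one fun d _ => ?_
  rw [card_digits]
  exact hl.pow

/-! ### The sign of a permutation -/

/-- The permutation `g` carries every sufficiently fine grid to a fine grid, with a number of
inversions of parity `c`. -/
def HasSign (g : Equiv.Perm (Pt n l)) (c : ZMod 2) : Prop :=
  ∃ K, ∀ A N J, K ≤ J → (∀ j d, K + A ≤ N j d) → ∃ N' J', J ≤ J' ∧ (∀ j d, A ≤ N' j d) ∧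
    (grid N J).map g.toEmbedding = grid N' J' ∧ inv (grid N J) g = c

lemma HasSign.unique {g : Equiv.Perm (Pt n l)} {c c' : ZMod 2} (h : HasSign g c)
    (h' : HasSign g c') : c = c' := by
  obtain ⟨K, hK⟩ := h
  obtain ⟨K', hK'⟩ := h'
  obtain ⟨_, _, _, _, _, h1⟩ := hK 0 (fun _ _ => K + K') (K + K') (by omega) (by intros; omega)
  obtain ⟨_, _, _, _, _, h2⟩ := hK' 0 (fun _ _ => K + K') (K + K') (by omega) (by intros; omega)
  exact h1.symm.trans h2

lemma hasSign_one : HasSign (1 : Equiv.Perm (Pt n l)) 0 := by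
  refine ⟨0, fun A N J _ hN => ⟨N, J, le_rfl, fun j d => by simpa using hN j d, ?_, ?_⟩⟩
  · ext p
    rw [Finset.mem_map_equiv]
    rfl
  · rw [inv_eq_sum]
    refine Finset.sum_eq_zero fun x _ => Finset.sum_eq_zero fun y _ => if_neg fun h => ?_
    exact h.1.not_gt h.2

lemma HasSign.mul {g h : Equiv.Perm (Pt n l)} {a b : ZMod 2} (hh : HasSign h a)
    (hg : HasSign g b) : HasSign (h * g) (a + b) := by
  obtain ⟨K, hK⟩ := hg
  obtain ⟨L, hL⟩ := hh
  refine ⟨K + L, fun A N J hJ hN => ?_⟩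
  obtain ⟨N', J', h1, h2, h3, h4⟩ := hK (L + A) N J (by omega) fun j d => by
    have := hN j d
    omega
  obtain ⟨N'', J'', h5, h6, h7, h8⟩ := hL A N' J' (by omega) h2
  refine ⟨N'', J'', h1.trans h5, h6, ?_, ?_⟩
  · rw [← h7, ← h3, Finset.map_map]
    rfl
  · rw [inv_comp, h3, h8, h4, add_comm]

omit [NeZero l] in
lemma map_perm_eq {T T' : Finset (Pt n l)} (g : Equiv.Perm (Pt n l))
    (h : ∀ z j, g (z, j) ∈ T' ↔ (z, j) ∈ T) : T.map g.toEmbedding = T' := by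
  ext p
  rw [Finset.mem_map_equiv]
  obtain ⟨⟨z, j⟩, rfl⟩ := g.surjective p
  rw [Equiv.symm_apply_apply, h]

omit [NeZero l] in
lemma zlt.not_zlt {x y : Fin n → ℕ → Fin l} (h : zlt x y) : ¬ zlt y x := fun h' =>
  ((key_lt x y 0 0).2 (Or.inr ⟨rfl, h⟩)).not_gt ((key_lt y x 0 0).2 (Or.inr ⟨rfl, h'⟩))

lemma IsTransp.hasSign {t : ℕ → Equiv.Perm (Pt n l)} (ht : IsTransp t) (hl : Odd l) (i : ℕ) :
    HasSign (t i) 1 := by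
  refine ⟨i + 2, fun A N J hJ hN => ⟨fun j => N (Equiv.swap i (i + 1) j), J, le_rfl,
    fun j d => le_trans (by omega) (hN (Equiv.swap i (i + 1) j) d), ?_, ?_⟩⟩
  · refine map_perm_eq _ fun z j => ?_
    rw [ht]
    split_ifs with h1 h2
    · subst h1
      simp only [mem_grid, Equiv.swap_apply_right]
      exact and_congr_left' (by omega)
    · subst h2
      simp only [mem_grid, Equiv.swap_apply_left]
      exact and_congr_left' (by omega)
    · simp only [mem_grid, Equiv.swap_apply_of_ne_of_ne h1 h2]
  · have key_iff : ∀ x y : Pt n l, (key x < key y ∧ key (t i y) < key (t i x)) ↔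
        (x.2 = i ∧ y.2 = i + 1) := by
      rintro ⟨x, a⟩ ⟨y, b⟩
      rw [ht, ht]
      dsimp only
      split_ifs <;> simp only [key_lt] <;>
        by_cases hxy : zlt x y <;> by_cases hyx : zlt y x <;>
        first
        | exact absurd hyx hxy.not_zlt
        | (simp only [hxy, hyx, and_true, and_false, or_false]; omega)
    have : (((grid N J) ×ˢ (grid N J)).filter fun q : Pt n l × Pt n l =>
        key q.1 < key q.2 ∧ key (t i q.2) < key (t i q.1)) =
        ((grid N J).filter fun p => p.2 = i) ×ˢ ((grid N J).filter fun p => p.2 = i + 1) := by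
      rw [← Finset.filter_product]
      exact Finset.filter_congr fun q _ => key_iff q.1 q.2
    rw [inv, this, Finset.card_product, ZMod.natCast_eq_one_iff_odd]
    exact (odd_card_level hl N (by omega)).mul (odd_card_level hl N (by omega))

/-- `x` and `y` first differ in a coordinate before `d`, in which `x` is smaller. -/
def zltBefore (d : Fin n) (x y : Fin n → ℕ → Fin l) : Prop :=
  ∃ e < d, (∀ e' < e, x e' = y e') ∧ ∃ m, (∀ m' < m, x e m' = y e m') ∧ x e m < y e m

omit [NeZero l] in
lemma zlt.shift {d : Fin n} {x y : Fin n → ℕ → Fin l} (h : zlt x y) (h0 : x d 0 = y d 0) :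
    zlt (shift d x) (shift d y) := by
  obtain ⟨e, he, m, hm, hlt⟩ := h
  refine ⟨e, fun e' h' => ?_, ?_⟩
  · by_cases hd : e' = d
    · subst hd
      funext m
      simp [he _ h']
    · rw [shift_of_ne hd, shift_of_ne hd, he _ h']
  · by_cases hd : e = d
    · subst hd
      obtain ⟨m, rfl⟩ : ∃ m', m = m' + 1 := by
        cases m with
        | zero => exact absurd hlt (by rw [h0]; exact lt_irrefl _)
        | succ m => exact ⟨m, rfl⟩
      exact ⟨m, fun m' h' => by simpa using hm (m' + 1) (by omega), by simpa using hlt⟩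
    · rw [shift_of_ne hd, shift_of_ne hd]
      exact ⟨m, hm, hlt⟩

omit [NeZero l] in
lemma zlt.before {d : Fin n} {x y : Fin n → ℕ → Fin l} (h : zlt x y) (h0 : y d 0 < x d 0) :
    zltBefore d x y := by
  obtain ⟨e, he, m, hm, hlt⟩ := h
  rcases lt_trichotomy e d with hd | rfl | hd
  · exact ⟨e, hd, he, m, hm, hlt⟩
  · cases m with
    | zero => exact absurd hlt h0.not_gt
    | succ m => exact absurd (hm 0 (by omega)) h0.ne'
  · rw [he d hd] at h0
    exact absurd h0 (lt_irrefl _)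

omit [NeZero l] in
lemma IsSplit.inversion_iff {s : ℕ → Fin n → Equiv.Perm (Pt n l)} (hs : IsSplit s) (i : ℕ)
    (d : Fin n) (x y : Pt n l) : (key x < key y ∧ key (s i d y) < key (s i d x)) ↔
      (x.2 = i ∧ y.2 = i ∧ zltBefore d x.1 y.1) ∧ y.1 d 0 < x.1 d 0 := by
  obtain ⟨x, a⟩ := x
  obtain ⟨y, b⟩ := y
  have hx := (x d 0).isLt
  have hy := (y d 0).isLt
  constructor
  · rintro ⟨h1, h2⟩
    rw [hs, hs] at h2
    rw [key_lt] at h1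
    dsimp only
    rcases h1 with h1 | ⟨rfl, h1⟩
    · exfalso
      split_ifs at h2 <;> simp only [key_lt] at h2 <;> omega
    · split_ifs at h2 with h3 h4
      · simp only [key_lt, lt_irrefl, false_or, true_and] at h2
        exact absurd h2 h1.not_zlt
      · subst h4
        simp only [key_lt] at h2
        rcases h2 with h2 | ⟨h2, h5⟩
        · have h6 : y d 0 < x d 0 := Fin.lt_def.2 (by omega)
          exact ⟨⟨rfl, rfl, h1.before h6⟩, h6⟩
        · exact absurd h5 (h1.shift (Fin.ext (by omega))).not_zlt
      · simp only [key_lt, lt_irrefl, false_or, true_and] at h2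
        exact absurd h2 h1.not_zlt
  · rintro ⟨⟨h1, h2, e, -, h3⟩, h4⟩
    dsimp only at h1 h2 h4
    subst h1 h2
    rw [hs, hs]
    simp only [lt_irrefl, if_false, if_true, key_lt, false_or, true_and]
    exact ⟨⟨e, h3⟩, Or.inl (by have := Fin.lt_def.1 h4; omega)⟩

/-- Replacing the first entry of the `d`-th coordinate by `a`. -/
def setHead (d : Fin n) (a : Fin l) (p : Pt n l) : Pt n l :=
  (Function.update p.1 d (Function.update (p.1 d) 0 a), p.2)

lemma setHead_mem {N : ℕ → Fin n → ℕ} {J : ℕ} {d : Fin n} (hN : ∀ j, 1 ≤ N j d) {p : Pt n l}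
    (a : Fin l) (hp : p ∈ grid N J) : setHead d a p ∈ grid N J := by
  obtain ⟨z, j⟩ := p
  rw [setHead, mem_grid]
  rw [mem_grid] at hp
  refine ⟨hp.1, fun e m hm => ?_⟩
  by_cases he : e = d
  · subst he
    have := hN j
    simpa [Function.update_of_ne (show m ≠ 0 by dsimp only at hm; omega)] using hp.2 e m hm
  · simpa [he] using hp.2 e m hm

omit [NeZero l] in
lemma zltBefore_setHead {d : Fin n} {p q : Pt n l} (a b : Fin l) (h : zltBefore d p.1 q.1) :
    zltBefore d (setHead d a p).1 (setHead d b q).1 := by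
  obtain ⟨e, he, h1, m, h2, h3⟩ := h
  refine ⟨e, he, fun e' h' => ?_, m, ?_, ?_⟩
  · simpa [setHead, (h'.trans he).ne] using h1 e' h'
  · simpa [setHead, he.ne] using h2
  · simpa [setHead, he.ne] using h3

omit [NeZero l] in
lemma setHead_setHead {d : Fin n} (a b : Fin l) {p : Pt n l} (h : p.1 d 0 = b) :
    setHead d b (setHead d a p) = p := by
  subst h
  simp [setHead]

omit [NeZero l] in
lemma setHead_apply {d : Fin n} (a : Fin l) (p : Pt n l) : (setHead d a p).1 d 0 = a := by
  simp [setHead]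

omit [NeZero l] in
lemma even_card_descents (hl : l % 4 = 1) :
    Even ((Finset.univ : Finset (Fin l × Fin l)).filter fun q => q.2 < q.1).card := by
  have h : ((Finset.univ : Finset (Fin l × Fin l)).filter fun q => q.2 < q.1).card =
      ∑ a ∈ Finset.range l, a := by
    rw [Finset.card_filter, ← Finset.univ_product_univ, Finset.sum_product,
      ← Fin.sum_univ_eq_sum_range (fun a => a) l]
    refine Finset.sum_congr rfl fun a _ => ?_
    rw [← Finset.card_filter]
    have : (Finset.univ.filter fun b => b < a) = Finset.Iio a := by ext; simp
    rw [this, Fin.card_Iio]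
  rw [h, Finset.sum_range_id]
  obtain ⟨q, rfl⟩ : ∃ q, l = 4 * q + 1 := ⟨l / 4, by omega⟩
  refine ⟨(4 * q + 1) * q, ?_⟩
  have : (4 * q + 1) * (4 * q + 1 - 1) = ((4 * q + 1) * q + (4 * q + 1) * q) * 2 := by
    rw [Nat.add_sub_cancel]
    ring
  rw [this, Nat.mul_div_cancel _ two_pos]

lemma IsSplit.inv_eq_zero {s : ℕ → Fin n → Equiv.Perm (Pt n l)} (hs : IsSplit s) (hl : l % 4 = 1)
    (i : ℕ) (d : Fin n) {N : ℕ → Fin n → ℕ} {J : ℕ} (hN : ∀ j, 1 ≤ N j d) :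
    inv (grid N J) (s i d) = 0 := by
  classical
  set P : Finset (Pt n l × Pt n l) := ((grid N J) ×ˢ (grid N J)).filter fun q =>
    q.1.2 = i ∧ q.2.2 = i ∧ zltBefore d q.1.1 q.2.1 with hP
  let head : Pt n l × Pt n l → Fin l × Fin l := fun q => (q.1.1 d 0, q.2.1 d 0)
  have hcard : ∀ a b, (P.filter fun q => head q = (a, b)).card =
      (P.filter fun q => head q = (0, 0)).card := by
    intro a b
    have maps : ∀ a b a' b', ∀ q ∈ P.filter (fun q => head q = (a, b)),
        (setHead d a' q.1, setHead d b' q.2) ∈ P.filter (fun q => head q = (a', b')) := by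
      intro a b a' b' q hq
      simp only [hP, Finset.mem_filter, Finset.mem_product] at hq ⊢
      refine ⟨⟨⟨setHead_mem hN _ hq.1.1.1, setHead_mem hN _ hq.1.1.2⟩, hq.1.2.1, hq.1.2.2.1,
        zltBefore_setHead _ _ hq.1.2.2.2⟩, ?_⟩
      simp [head, setHead_apply]
    have inverse : ∀ a b a' b', ∀ q ∈ P.filter (fun q => head q = (a, b)),
        (setHead d a (setHead d a' q.1), setHead d b (setHead d b' q.2)) = q := by
      intro a b a' b' q hq
      have h := Prod.mk.inj (Finset.mem_filter.1 hq).2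
      rw [setHead_setHead _ _ h.1, setHead_setHead _ _ h.2]
    exact Finset.card_nbij' (fun q => (setHead d 0 q.1, setHead d 0 q.2))
      (fun q => (setHead d a q.1, setHead d b q.2)) (maps a b 0 0) (maps 0 0 a b)
      (inverse a b 0 0) (inverse 0 0 a b)
  have hfilter : (((grid N J) ×ˢ (grid N J)).filter fun q : Pt n l × Pt n l =>
      key q.1 < key q.2 ∧ key (s i d q.2) < key (s i d q.1)) =
      P.filter fun q => q.2.1 d 0 < q.1.1 d 0 := by
    rw [hP, Finset.filter_filter]
    exact Finset.filter_congr fun q _ => hs.inversion_iff i d q.1 q.2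
  rw [inv, hfilter, ZMod.natCast_eq_zero_iff_even, Finset.card_eq_sum_card_fiberwise (f := head)
    (t := Finset.univ.filter fun q : Fin l × Fin l => q.2 < q.1)]
  · rw [Finset.sum_congr rfl (g := fun _ => (P.filter fun q => head q = (0, 0)).card),
      Finset.sum_const, smul_eq_mul]
    · exact (even_card_descents hl).mul_right _
    · rintro ⟨a, b⟩ hab
      rw [← hcard a b, Finset.filter_filter]
      refine congrArg _ (Finset.filter_congr fun q _ => and_iff_right_of_imp fun h => ?_)
      have h' := Prod.mk.inj h
      rw [h'.1, h'.2]
      exact (Finset.mem_filter.1 hab).2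
  · intro q hq
    simpa using (Finset.mem_filter.1 hq).2

lemma IsSplit.hasSign {s : ℕ → Fin n → Equiv.Perm (Pt n l)} (hs : IsSplit s) (hl : l % 4 = 1)
    (i : ℕ) (d : Fin n) : HasSign (s i d) 0 := by
  have hl0 : 0 < l := NeZero.pos l
  refine ⟨i + 1, fun A N J hJ hN => ⟨fun j => if j < i then N j else if j < i + l then
    Function.update (N i) d (N i d - 1) else N (j - (l - 1)), J + (l - 1), by omega,
    fun j e => ?_, map_perm_eq _ fun z j => ?_,
    hs.inv_eq_zero hl i d fun j => by have := hN j d; omega⟩⟩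
  · dsimp only
    split_ifs with h1 h2
    · have := hN j e
      omega
    · have := hN i e
      by_cases he : e = d
      · subst he
        rw [Function.update_self]
        omega
      · rw [Function.update_of_ne he]
        omega
    · have := hN (j - (l - 1)) e
      omega
  · rw [hs]
    have hz := (z d 0).isLt
    split_ifs with h1 h2
    · simp only [mem_grid, h1, if_true]
      exact and_congr_left' (by omega)
    · subst h2
      simp only [mem_grid]
      rw [if_neg (by omega), if_pos (by omega)]
      refine and_congr (by omega) (forall_congr' fun e => ?_)
      by_cases he : e = d
      · subst he
        have := hN j e
        simp only [Function.update_self, shift_self]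
        constructor
        · intro h m hm
          obtain ⟨m, rfl⟩ : ∃ m', m = m' + 1 := ⟨m - 1, by omega⟩
          exact h m (by omega)
        · intro h m hm
          exact h _ (by omega)
      · rw [Function.update_of_ne he, shift_of_ne he]
    · simp only [mem_grid]
      rw [if_neg (by omega), if_neg (by omega), Nat.add_sub_cancel]
      exact and_congr_left' (by omega)

/-! ### The monoid generated by the `s_{i,d}` and `τ_i` -/

/-- The permutation of `Z(n,k) × ℕ` permuting the levels by `σ`. -/
def levelPerm (n l : ℕ) : Equiv.Perm ℕ →* Equiv.Perm (Pt n l) where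
  toFun σ := Equiv.prodCongr (Equiv.refl _) σ
  map_one' := rfl
  map_mul' _ _ := rfl

/-- The set of all `s_{i,d}` and `τ_i`. -/
def generators (s : ℕ → Fin n → Equiv.Perm (Pt n l)) (t : ℕ → Equiv.Perm (Pt n l)) :
    Set (Equiv.Perm (Pt n l)) :=
  {g | ∃ i d, g = s i d} ∪ {g | ∃ i, g = t i}

/-- The composition `s_{i,d} s_{i+1,d} ⋯ s_{i+r-1,d}`, which splits `r` consecutive levels. -/
def block (s : ℕ → Fin n → Equiv.Perm (Pt n l)) (d : Fin n) (i : ℕ) : ℕ → Equiv.Perm (Pt n l)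
  | 0 => 1
  | r + 1 => block s d i r * s (i + r) d

/-- The involution of `ℕ` transposing the `l × l` block of numbers starting at `o`. -/
def transposeFun (l o x : ℕ) : ℕ :=
  if o ≤ x ∧ x < o + l * l then o + (l * ((x - o) % l) + (x - o) / l) else x

lemma transposeFun_apply (l o a b : ℕ) (ha : a < l) (hb : b < l) :
    transposeFun l o (o + (l * a + b)) = o + (l * b + a) := by
  have h : l * a + b < l * l := by nlinarith
  rw [transposeFun, if_pos (by omega), Nat.add_sub_cancel_left, Nat.mul_add_mod,
    Nat.mod_eq_of_lt hb, Nat.mul_add_div (by omega), Nat.div_eq_of_lt hb, add_zero]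

lemma transposeFun_of_not (l o x : ℕ) (h : ¬ (o ≤ x ∧ x < o + l * l)) :
    transposeFun l o x = x := if_neg h

lemma transposeFun_involutive (l o : ℕ) : Function.Involutive (transposeFun l o) := by
  intro x
  by_cases h : o ≤ x ∧ x < o + l * l
  · have hl : 0 < l := by
      rcases Nat.eq_zero_or_pos l with rfl | hl
      · omega
      · exact hl
    have hb := Nat.mod_lt (x - o) hl
    have ha : (x - o) / l < l := (Nat.div_lt_iff_lt_mul hl).2 (by omega)
    have hx : x = o + (l * ((x - o) / l) + (x - o) % l) := by
      rw [Nat.div_add_mod]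
      omega
    rw [hx, transposeFun_apply _ _ _ _ ha hb, transposeFun_apply _ _ _ _ hb ha]
  · rw [transposeFun_of_not l o x h, transposeFun_of_not l o x h]

/-- The involution of `ℕ` interchanging the intervals `[o, o + l)` and `[o + l, o + 2l)`. -/
def swapFun (l o x : ℕ) : ℕ :=
  if o ≤ x ∧ x < o + l then x + l else if o + l ≤ x ∧ x < o + l + l then x - l else x

lemma swapFun_involutive (l o : ℕ) : Function.Involutive (swapFun l o) := by
  intro x
  unfold swapFun
  split_ifs <;> omega

omit [NeZero l] in
lemma block_apply {s : ℕ → Fin n → Equiv.Perm (Pt n l)} (hs : IsSplit s) (hl : 0 < l)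
    (d : Fin n) (i r : ℕ) (z : Fin n → ℕ → Fin l) (j : ℕ) : block s d i r (z, j) =
      if j < i then (z, j) else if j < i + r then (shift d z, i + (l * (j - i) + (z d 0 : ℕ)))
      else (z, j + (l - 1) * r) := by
  induction r generalizing z j with
  | zero =>
    simp only [block, Equiv.Perm.one_apply, add_zero, mul_zero]
    split_ifs <;> rfl
  | succ r ih =>
    rw [block, Equiv.Perm.mul_apply, hs]
    have e1 : (l - 1) * (r + 1) = (l - 1) * r + (l - 1) := by ring
    have e2 : l * r = (l - 1) * r + r := by
      obtain ⟨q, rfl⟩ : ∃ q, l = q + 1 := ⟨l - 1, by omega⟩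
      simp only [Nat.add_sub_cancel]
      ring
    split_ifs with h1 h2 h3 h4 h5 h6
    · rw [ih, if_pos h2]
    · rw [ih, if_neg h2, if_pos h1]
    · omega
    · omega
    · subst h4
      rw [ih, if_neg (by omega), if_neg (by omega), Nat.add_sub_cancel_left]
      exact Prod.ext rfl (by dsimp only; omega)
    · omega
    · omega
    · omega
    · rw [ih, if_neg (by omega), if_neg (by omega)]
      exact Prod.ext rfl (by dsimp only; omega)

section Monoid

variable {s : ℕ → Fin n → Equiv.Perm (Pt n l)} {t : ℕ → Equiv.Perm (Pt n l)}

omit [NeZero l]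

lemma IsTransp.eq_levelPerm (ht : IsTransp t) (i : ℕ) :
    t i = levelPerm n l (Equiv.swap i (i + 1)) := by
  ext1 ⟨z, j⟩
  rw [ht]
  refine Eq.trans ?_ (show (z, Equiv.swap i (i + 1) j) = _ from rfl)
  rw [Equiv.swap_apply_def]
  split_ifs <;> rfl

lemma split_mem (i : ℕ) (d : Fin n) : s i d ∈ Submonoid.closure (generators s t) :=
  Submonoid.subset_closure (Or.inl ⟨i, d, rfl⟩)

lemma transp_mem (i : ℕ) : t i ∈ Submonoid.closure (generators s t) :=
  Submonoid.subset_closure (Or.inr ⟨i, rfl⟩)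

lemma block_mem (d : Fin n) (i r : ℕ) : block s d i r ∈ Submonoid.closure (generators s t) := by
  induction r with
  | zero => exact one_mem _
  | succ r ih => exact mul_mem ih (split_mem _ _)

lemma levelPerm_mem (ht : IsTransp t) (σ : Equiv.Perm ℕ) (K : ℕ) (hσ : ∀ x ≥ K, σ x = x) :
    levelPerm n l σ ∈ Submonoid.closure (generators s t) := by
  let H : Subgroup (Equiv.Perm ℕ) :=
    { carrier := {τ | levelPerm n l τ ∈ Submonoid.closure (generators s t) ∧
        levelPerm n l τ⁻¹ ∈ Submonoid.closure (generators s t)}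
      one_mem' := ⟨by simp, by simp⟩
      mul_mem' := fun {a b} ha hb => ⟨by rw [map_mul]; exact mul_mem ha.1 hb.1, by
        rw [mul_inv_rev, map_mul]; exact mul_mem hb.2 ha.2⟩
      inv_mem' := fun {a} ha => ⟨ha.2, by rw [inv_inv]; exact ha.1⟩ }
  have hadj : ∀ i, Equiv.swap i (i + 1) ∈ H := fun i => by
    have h : levelPerm n l (Equiv.swap i (i + 1)) ∈ Submonoid.closure (generators s t) := by
      rw [← ht.eq_levelPerm]
      exact transp_mem i
    exact ⟨h, by rwa [Equiv.swap_inv]⟩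
  have hdist : ∀ a r, Equiv.swap a (a + r) ∈ H := by
    intro a r
    induction r with
    | zero => rw [add_zero, Equiv.swap_self]; exact one_mem H
    | succ r ih => exact SubmonoidClass.swap_mem_trans H ih (hadj (a + r))
  have hswap : ∀ a b, Equiv.swap a b ∈ H := by
    intro a b
    rcases le_total a b with h | h
    · obtain ⟨r, rfl⟩ := Nat.exists_eq_add_of_le h
      exact hdist a r
    · obtain ⟨r, rfl⟩ := Nat.exists_eq_add_of_le h
      rw [Equiv.swap_comm]
      exact hdist b r
  have hle : Subgroup.closure {σ : Equiv.Perm ℕ | σ.IsSwap} ≤ H := by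
    rw [Subgroup.closure_le]
    rintro _ ⟨a, b, -, rfl⟩
    exact hswap a b
  refine (hle (mem_closure_isSwap'.2 ?_)).1
  refine (Set.finite_lt_nat K).subset fun x hx => ?_
  by_contra h
  exact hx (hσ x (not_lt.1 h))

lemma block_mul_transp (hs : IsSplit s) (ht : IsTransp t) (hl : 0 < l) (d : Fin n) {i J : ℕ}
    (hJ : i + 2 ≤ J) : block s d 0 J * t i =
      levelPerm n l (swapFun_involutive l (l * i)).toPerm * block s d 0 J := by
  have hi : l * (i + 1) = l * i + l := by ring
  have hle : l * (i + 2) ≤ l * J := Nat.mul_le_mul_left _ hJ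
  have hi2 : l * (i + 2) = l * i + l + l := by ring
  have hlJ : l * J = (l - 1) * J + J := by
    obtain ⟨q, rfl⟩ : ∃ q, l = q + 1 := ⟨l - 1, by omega⟩
    simp only [Nat.add_sub_cancel]
    ring
  ext1 ⟨z, j⟩
  have hz := (z d 0).isLt
  have hlev : ∀ (w : Fin n → ℕ → Fin l) a,
      levelPerm n l (swapFun_involutive l (l * i)).toPerm (w, a) = (w, swapFun l (l * i) a) :=
    fun _ _ => rfl
  rw [Equiv.Perm.mul_apply, Equiv.Perm.mul_apply, ht, block_apply hs hl d 0 J z j,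
    if_neg (Nat.not_lt_zero _)]
  rcases lt_trichotomy j i with h1 | rfl | h1
  · have : l * (j + 1) ≤ l * i := Nat.mul_le_mul_left _ h1
    have : l * (j + 1) = l * j + l := by ring
    rw [if_neg (by omega), if_neg (by omega), block_apply hs hl, if_neg (by omega),
      if_pos (by omega), hlev]
    refine Prod.ext rfl ?_
    simp only [swapFun, Nat.sub_zero]
    split_ifs <;> omega
  · rw [if_pos rfl, block_apply hs hl, if_neg (by omega),
      if_pos (by omega), if_pos (by omega), hlev]
    refine Prod.ext rfl ?_
    simp only [swapFun, Nat.sub_zero]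
    split_ifs <;> omega
  · rw [if_neg (by omega)]
    by_cases h2 : j = i + 1
    · subst h2
      rw [if_pos rfl, block_apply hs hl, if_neg (by omega),
        if_pos (by omega), if_pos (by omega), hlev]
      refine Prod.ext rfl ?_
      simp only [swapFun, Nat.sub_zero]
      split_ifs <;> omega
    · have : l * (i + 2) ≤ l * j := Nat.mul_le_mul_left _ (by omega)
      rw [if_neg h2, block_apply hs hl, if_neg (by omega)]
      split_ifs with h3
      · rw [hlev]
        refine Prod.ext rfl ?_
        simp only [swapFun, Nat.sub_zero]
        split_ifs <;> omega
      · rw [hlev]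
        refine Prod.ext rfl ?_
        simp only [swapFun]
        split_ifs <;> omega

lemma block_mul_split (hs : IsSplit s) (hl : 0 < l) {d e : Fin n} {i J : ℕ}
    (hJ : i + 1 ≤ J) (π : Equiv.Perm ℕ) (hπ : ∀ x, ¬ (l * i ≤ x ∧ x < l * i + l * l) → π x = x)
    (hπ' : ∀ z : Fin n → ℕ → Fin l, (shift d (shift e z), l * i + (l * z e 0 + shift e z d 0)) =
      (shift e (shift d z), π (l * i + (l * z d 0 + shift d z e 0)))) :
    block s d 0 (J + (l - 1)) * s i e =
      levelPerm n l π * (block s e (l * i) l * block s d 0 J) := by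
  have hi : l * (i + 1) = l * i + l := by ring
  have hle : l * (i + 1) ≤ l * J := Nat.mul_le_mul_left _ hJ
  have hlJ : l * J = (l - 1) * J + J := by
    obtain ⟨q, rfl⟩ : ∃ q, l = q + 1 := ⟨l - 1, by omega⟩
    simp only [Nat.add_sub_cancel]
    ring
  have hll : l * l = (l - 1) * l + l := by
    obtain ⟨q, rfl⟩ : ∃ q, l = q + 1 := ⟨l - 1, by omega⟩
    simp only [Nat.add_sub_cancel]
    ring
  have hll' : (l - 1) * l = (l - 1) * (l - 1) + (l - 1) := by
    obtain ⟨q, rfl⟩ : ∃ q, l = q + 1 := ⟨l - 1, by omega⟩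
    simp only [Nat.add_sub_cancel]
    ring
  have hlev : ∀ (w : Fin n → ℕ → Fin l) a, levelPerm n l π (w, a) = (w, π a) :=
    fun _ _ => rfl
  ext1 ⟨z, j⟩
  have hz := (z d 0).isLt
  have hz' := (z e 0).isLt
  rw [Equiv.Perm.mul_apply, Equiv.Perm.mul_apply, Equiv.Perm.mul_apply, hs,
    block_apply hs hl d 0 J, if_neg (Nat.not_lt_zero _)]
  rcases lt_trichotomy j i with h1 | rfl | h1
  · have : l * (j + 1) ≤ l * i := Nat.mul_le_mul_left _ h1
    have : l * (j + 1) = l * j + l := by ring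
    rw [if_pos h1, block_apply hs hl, if_neg (by omega), if_pos (by omega), if_pos (by omega),
      Nat.sub_zero, block_apply hs hl, if_pos (by omega), hlev, hπ _ (by omega)]
  · rw [if_neg (lt_irrefl _), if_pos rfl, block_apply hs hl, if_neg (by omega),
      if_pos (by omega), if_pos (by omega), Nat.sub_zero, Nat.sub_zero, block_apply hs hl,
      if_neg (by omega), if_pos (by omega), hlev]
    have h2 := hπ' z
    have e1 : 0 + (l * (j + (z e 0 : ℕ)) + (shift e z d 0 : ℕ)) =
        l * j + (l * z e 0 + shift e z d 0) := by ring
    have e2 : 0 + (l * j + (z d 0 : ℕ)) - l * j = z d 0 := by omega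
    rw [e1, e2]
    exact h2
  · have hij : l * (i + 1) ≤ l * j := Nat.mul_le_mul_left _ h1
    rw [if_neg (by omega), if_neg (by omega), block_apply hs hl, if_neg (by omega)]
    by_cases h2 : j < J
    · have e1 : l * (j + (l - 1)) = l * j + (l - 1) * l := by ring
      rw [if_pos (by omega), if_pos (by omega), Nat.sub_zero, Nat.sub_zero, block_apply hs hl,
        if_neg (by omega), if_neg (by omega), hlev, hπ _ (by omega)]
      exact Prod.ext rfl (by dsimp only; omega)
    · have e1 : (l - 1) * (J + (l - 1)) = (l - 1) * J + (l - 1) * (l - 1) := by ring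
      rw [if_neg (by omega), if_neg (by omega), block_apply hs hl,
        if_neg (by omega), if_neg (by omega), hlev, hπ _ (by omega)]
      exact Prod.ext rfl (by dsimp only; omega)

lemma exists_block_mul_eq (hs : IsSplit s) (ht : IsTransp t) (hl : 0 < l) (d : Fin n)
    {m : Equiv.Perm (Pt n l)} (hm : m ∈ Submonoid.closure (generators s t)) :
    ∃ J₀, ∀ J ≥ J₀, ∃ J' ≥ J, ∃ m' ∈ Submonoid.closure (generators s t),
      block s d 0 J' * m = m' * block s d 0 J := by
  induction hm using Submonoid.closure_induction with
  | one => exact ⟨0, fun J _ => ⟨J, le_rfl, 1, one_mem _, by simp⟩⟩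
  | mul g h _ _ hg hh =>
    obtain ⟨J₁, h1⟩ := hg
    obtain ⟨J₂, h2⟩ := hh
    refine ⟨J₁ + J₂, fun J hJ => ?_⟩
    obtain ⟨J', hJ', h', hm', e1⟩ := h2 J (by omega)
    obtain ⟨J'', hJ'', g', hg', e2⟩ := h1 J' (by omega)
    exact ⟨J'', hJ'.trans hJ'', g' * h', mul_mem hg' hm', by
      rw [← mul_assoc, e2, mul_assoc, e1, mul_assoc]⟩
  | mem g hg =>
    rcases hg with ⟨i, e, rfl⟩ | ⟨i, rfl⟩
    · refine ⟨i + 1, fun J hJ => ⟨J + (l - 1), by omega, ?_⟩⟩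
      by_cases hde : d = e
      · subst hde
        exact ⟨_, mul_mem (levelPerm_mem ht 1 0 fun _ _ => rfl) (block_mem _ _ _), by
          rw [block_mul_split hs hl hJ 1 (fun _ _ => rfl) fun _ => rfl, mul_assoc]⟩
      · refine ⟨_, mul_mem (levelPerm_mem ht (transposeFun_involutive l (l * i)).toPerm
          (l * i + l * l) fun _ _ => transposeFun_of_not _ _ _ (by omega)) (block_mem _ _ _),
          (block_mul_split hs hl hJ (transposeFun_involutive l (l * i)).toPerm
            (fun x hx => transposeFun_of_not _ _ _ hx) fun z => ?_).trans
            (mul_assoc _ _ _).symm⟩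
        rw [Function.Involutive.coe_toPerm, shift_of_ne hde, shift_of_ne (Ne.symm hde),
          transposeFun_apply _ _ _ _ (Fin.isLt _) (Fin.isLt _), shift_comm (Ne.symm hde)]
    · refine ⟨i + 2, fun J hJ => ⟨J, le_rfl, _, levelPerm_mem ht
        (swapFun_involutive l (l * i)).toPerm (l * i + l + l) fun x hx => ?_,
        block_mul_transp hs ht hl d hJ⟩⟩
      rw [Function.Involutive.coe_toPerm, swapFun, if_neg (by omega), if_neg (by omega)]

lemma IsSplit.mul_split (hs : IsSplit s) (d : Fin n) {i j : ℕ} (hij : i < j) :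
    s i d * s j d = s (j + (l - 1)) d * s i d := by
  ext1 ⟨z, a⟩
  have hz := (z d 0).isLt
  rw [Equiv.Perm.mul_apply, Equiv.Perm.mul_apply, hs j, hs i d z a]
  rcases lt_trichotomy a i with h1 | rfl | h1
  · rw [if_pos (by omega), if_pos h1, hs, hs, if_pos h1, if_pos (by omega)]
  · rw [if_pos hij, if_neg (lt_irrefl _), if_pos rfl, hs, hs, if_neg (lt_irrefl _), if_pos rfl,
      if_pos (by omega)]
  · rw [if_neg (not_lt.2 h1.le) (c := a < i), if_neg h1.ne']
    rcases lt_trichotomy a j with h2 | rfl | h2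
    · rw [if_pos h2, hs, hs, if_neg (by omega), if_neg (by omega), if_pos (by omega)]
    · rw [if_neg (lt_irrefl _), if_pos rfl, hs, hs, if_neg (by omega), if_neg (by omega),
        if_neg (lt_irrefl _), if_pos rfl]
      exact Prod.ext rfl (by dsimp only; omega)
    · rw [if_neg (by omega), if_neg (by omega), hs, hs, if_neg (by omega), if_neg (by omega),
        if_neg (by omega), if_neg (by omega)]

lemma exists_block_eq_mul (hs : IsSplit s) (d : Fin n) (i r : ℕ) :
    ∃ m ∈ Submonoid.closure (generators s t), block s d 0 (i + 1 + r) = m * s i d := by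
  suffices h : ∀ r, ∃ b ∈ Submonoid.closure (generators s t),
      s i d * block s d (i + 1) r = b * s i d by
    obtain ⟨b, hb, e⟩ := h r
    refine ⟨block s d 0 i * b, mul_mem (block_mem _ _ _) hb, ?_⟩
    rw [mul_assoc, ← e, ← mul_assoc]
    clear e
    induction r with
    | zero => simp [block]
    | succ r ih => rw [← add_assoc, block, ih, block, zero_add, mul_assoc]
  intro r
  induction r with
  | zero => exact ⟨1, one_mem _, by simp [block]⟩
  | succ r ih =>
    obtain ⟨b, hb, e⟩ := ih
    exact ⟨b * s (i + 1 + r + (l - 1)) d, mul_mem hb (split_mem _ _), by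
      rw [block, ← mul_assoc, e, mul_assoc, hs.mul_split d (by omega), mul_assoc]⟩

end Monoid

/-! ### The sign homomorphism -/

section Sign

variable {s : ℕ → Fin n → Equiv.Perm (Pt n l)} {t : ℕ → Equiv.Perm (Pt n l)}

/-- The generators together with their signs. -/
def signedGenerators (s : ℕ → Fin n → Equiv.Perm (Pt n l)) (t : ℕ → Equiv.Perm (Pt n l)) :
    Set (Equiv.Perm (Pt n l) × Multiplicative (ZMod 2)) :=
  {x | ∃ i d, x = (s i d, 1)} ∪ {x | ∃ i, x = (t i, Multiplicative.ofAdd 1)}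

omit [NeZero l] in
lemma exists_common_left_multiple (hs : IsSplit s) (ht : IsTransp t) (hl : 0 < l)
    {m g : Equiv.Perm (Pt n l)} (hm : m ∈ Submonoid.closure (generators s t))
    (hg : g ∈ generators s t) :
    ∃ a ∈ Submonoid.closure (generators s t), ∃ b ∈ Submonoid.closure (generators s t),
      a * m = b * g := by
  rcases hg with ⟨i, d, rfl⟩ | ⟨i, rfl⟩
  · obtain ⟨J₀, hJ₀⟩ := exists_block_mul_eq hs ht hl d hm
    obtain ⟨J', _, m', hm', e⟩ := hJ₀ (i + 1 + J₀) (by omega)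
    obtain ⟨b, hb, e'⟩ := exists_block_eq_mul (t := t) hs d i J₀
    exact ⟨_, block_mem d 0 J', m' * b, mul_mem hm' hb, by rw [e, e', mul_assoc]⟩
  · refine ⟨1, one_mem _, m * t i, mul_mem hm (transp_mem i), ?_⟩
    rw [mul_assoc, ht.eq_levelPerm, ← map_mul, Equiv.swap_mul_self, map_one, one_mul, mul_one]

omit [NeZero l] in
lemma exists_signed_generator {g : Equiv.Perm (Pt n l)} (hg : g ∈ generators s t) :
    ∃ c, (g, c) ∈ signedGenerators s t := by
  rcases hg with ⟨i, d, rfl⟩ | ⟨i, rfl⟩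
  · exact ⟨1, Or.inl ⟨i, d, rfl⟩⟩
  · exact ⟨_, Or.inr ⟨i, rfl⟩⟩

omit [NeZero l] in
lemma exists_signed_of_mem_submonoid {g : Equiv.Perm (Pt n l)}
    (hg : g ∈ Submonoid.closure (generators s t)) :
    ∃ c, (g, c) ∈ Submonoid.closure (signedGenerators s t) := by
  induction hg using Submonoid.closure_induction with
  | one => exact ⟨1, one_mem _⟩
  | mul g h _ _ hg hh =>
    obtain ⟨a, ha⟩ := hg
    obtain ⟨b, hb⟩ := hh
    exact ⟨a * b, mul_mem ha hb⟩
  | mem g hg =>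
    obtain ⟨c, hc⟩ := exists_signed_generator hg
    exact ⟨c, Submonoid.subset_closure hc⟩

omit [NeZero l] in
lemma exists_signed_of_mem_subgroup {g : Equiv.Perm (Pt n l)}
    (hg : g ∈ Subgroup.closure (generators s t)) :
    ∃ c, (g, c) ∈ Subgroup.closure (signedGenerators s t) := by
  induction hg using Subgroup.closure_induction with
  | one => exact ⟨1, one_mem _⟩
  | mul g h _ _ hg hh =>
    obtain ⟨a, ha⟩ := hg
    obtain ⟨b, hb⟩ := hh
    exact ⟨a * b, mul_mem ha hb⟩
  | inv g _ hg =>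
    obtain ⟨a, ha⟩ := hg
    exact ⟨a⁻¹, inv_mem ha⟩
  | mem g hg =>
    obtain ⟨c, hc⟩ := exists_signed_generator hg
    exact ⟨c, Subgroup.subset_closure hc⟩

omit [NeZero l] in
lemma fst_mem_of_signed {x : Equiv.Perm (Pt n l) × Multiplicative (ZMod 2)}
    (hx : x ∈ Submonoid.closure (signedGenerators s t)) :
    x.1 ∈ Submonoid.closure (generators s t) := by
  induction hx using Submonoid.closure_induction with
  | one => exact one_mem _
  | mul x y _ _ hx hy => exact mul_mem hx hy
  | mem x hx =>
    rcases hx with ⟨i, d, rfl⟩ | ⟨i, rfl⟩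
    · exact split_mem i d
    · exact transp_mem i

lemma hasSign_of_signed (hs : IsSplit s) (ht : IsTransp t) (hl : l % 4 = 1)
    {x : Equiv.Perm (Pt n l) × Multiplicative (ZMod 2)}
    (hx : x ∈ Submonoid.closure (signedGenerators s t)) : HasSign x.1 x.2.toAdd := by
  induction hx using Submonoid.closure_induction with
  | one => exact hasSign_one
  | mul x y _ _ hx hy => exact hx.mul hy
  | mem x hx =>
    rcases hx with ⟨i, d, rfl⟩ | ⟨i, rfl⟩
    · exact hs.hasSign hl i d
    · exact ht.hasSign (Nat.odd_iff.2 (by omega)) i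

lemma signed_eq (hs : IsSplit s) (ht : IsTransp t) (hl : l % 4 = 1)
    {x y : Equiv.Perm (Pt n l) × Multiplicative (ZMod 2)}
    (hx : x ∈ Submonoid.closure (signedGenerators s t))
    (hy : y ∈ Submonoid.closure (signedGenerators s t)) (h : x.1 = y.1) : x = y := by
  have hx' := hasSign_of_signed hs ht hl hx
  rw [h] at hx'
  exact Prod.ext h (Multiplicative.toAdd.injective
    (hx'.unique (hasSign_of_signed hs ht hl hy)))

lemma exists_mul_mem_submonoid (hs : IsSplit s) (ht : IsTransp t) (hl : l % 4 = 1)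
    {w : Equiv.Perm (Pt n l) × Multiplicative (ZMod 2)}
    (hw : w ∈ Subgroup.closure (signedGenerators s t)) :
    ∃ a ∈ Submonoid.closure (signedGenerators s t),
      a * w ∈ Submonoid.closure (signedGenerators s t) := by
  induction hw using Subgroup.closure_induction_right with
  | one => exact ⟨1, one_mem _, by rw [mul_one]; exact one_mem _⟩
  | mul_right w _ g hg ih =>
    obtain ⟨a, ha, haw⟩ := ih
    exact ⟨a, ha, by rw [← mul_assoc]; exact mul_mem haw (Submonoid.subset_closure hg)⟩
  | mul_inv_cancel w _ g hg ih =>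
    obtain ⟨a, ha, haw⟩ := ih
    have hg' : g.1 ∈ generators s t := by
      rcases hg with ⟨i, d, rfl⟩ | ⟨i, rfl⟩
      · exact Or.inl ⟨i, d, rfl⟩
      · exact Or.inr ⟨i, rfl⟩
    obtain ⟨b, hb, c, hc, e⟩ :=
      exists_common_left_multiple hs ht (NeZero.pos l) (fst_mem_of_signed haw) hg'
    obtain ⟨β, hβ⟩ := exists_signed_of_mem_submonoid hb
    obtain ⟨γ, hγ⟩ := exists_signed_of_mem_submonoid hc
    have h := signed_eq hs ht hl (mul_mem hβ haw) (mul_mem hγ (Submonoid.subset_closure hg)) e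
    refine ⟨(b, β) * a, mul_mem hβ ha, ?_⟩
    rw [← mul_assoc, mul_assoc _ a w, h, mul_inv_cancel_right]
    exact hγ

lemma signed_unique (hs : IsSplit s) (ht : IsTransp t) (hl : l % 4 = 1)
    {g : Equiv.Perm (Pt n l)} {c c' : Multiplicative (ZMod 2)}
    (h : (g, c) ∈ Subgroup.closure (signedGenerators s t))
    (h' : (g, c') ∈ Subgroup.closure (signedGenerators s t)) : c = c' := by
  obtain ⟨a, ha, haw⟩ := exists_mul_mem_submonoid hs ht hl (mul_mem (inv_mem h) h')
  have e := signed_eq hs ht hl ha haw (by simp)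
  have e2 := mul_eq_left.1 e.symm
  exact inv_mul_eq_one.1 (congrArg Prod.snd e2)

lemma exists_sign_hom (hs : IsSplit s) (ht : IsTransp t) (hl : l % 4 = 1) :
    ∃ ρ : ↥(Subgroup.closure (generators s t)) →* Multiplicative (ZMod 2),
      ∀ (g : ↥(Subgroup.closure (generators s t))) c,
        ((g : Equiv.Perm (Pt n l)), c) ∈ Subgroup.closure (signedGenerators s t) →
        ρ g = c := by
  choose ρ hρ using fun g : ↥(Subgroup.closure (generators s t)) =>
    exists_signed_of_mem_subgroup g.2
  exact ⟨MonoidHom.mk' ρ fun g h =>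
    signed_unique hs ht hl (hρ (g * h)) (mul_mem (hρ g) (hρ h)),
    fun g c hc => signed_unique hs ht hl (hρ g) hc⟩

end Sign

end WGroup

theorem statement8 (n l : ℕ) (hn : 2 ≤ n) (hl : 5 ≤ l) (hl4 : l % 4 = 1)
    (s : ℕ → Fin n → Equiv.Perm (WGroup.Sp n fun _ => l))
    (t : ℕ → Equiv.Perm (WGroup.Sp n fun _ => l))
    (hs : ∀ i d p, s i d p = WGroup.sMap (fun _ => l) i d p)
    (ht : ∀ i p, t i p = WGroup.tMap (fun _ => l) i p) :
    ∃ ρ : ↥(Subgroup.closure (WGroup.gens (fun _ => l) s t)) →* Multiplicative (ZMod 2),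
      (∀ (i : ℕ) (d : Fin n) (h : s i d ∈ Subgroup.closure (WGroup.gens (fun _ => l) s t)),
        ρ ⟨s i d, h⟩ = Multiplicative.ofAdd (0 : ZMod 2)) ∧
      (∀ (i : ℕ) (h : t i ∈ Subgroup.closure (WGroup.gens (fun _ => l) s t)),
        ρ ⟨t i, h⟩ = Multiplicative.ofAdd (1 : ZMod 2)) := by
  have : NeZero l := ⟨by omega⟩
  obtain ⟨ρ, hρ⟩ := WGroup.exists_sign_hom (s := s) (t := t)
    (fun i d z j => hs i d (z, j)) (fun i z j => ht i (z, j)) hl4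
  exact ⟨ρ, fun i d h => hρ ⟨_, h⟩ _ (Subgroup.subset_closure (Or.inl ⟨i, d, rfl⟩)),
    fun i h => hρ ⟨_, h⟩ _ (Subgroup.subset_closure (Or.inr ⟨i, rfl⟩))⟩
end

section
/- Let n ≥ 2 and let k : {1,…,n} → {2,3,…} be given by k(1) = 3 and k(d) = 5 for 2 ≤ d ≤ n. Then there exists a group homomorphism ρ : W(n,k) → ℤ/2ℤ such that ρ(s_{i,d}) = 0 and ρ(τ_i) = 1 for all i ∈ ℕ and all d ∈ {1,…,n}. -/
/-- The arity function for STATEMENT 9: `k(1) = 3` and `k(d) = 5` for `d ≥ 2`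
(with `0`-based indexing: `k 0 = 3`, `k d = 5` for `d ≠ 0`). -/
def kNine (n : ℕ) : Fin n → ℕ := fun d => if (d : ℕ) = 0 then 3 else 5

namespace WGroup

/-- Prepend a letter to a sequence. -/
def consSeq {α : Type*} (a : α) (x : ℕ → α) : ℕ → α
  | 0 => a
  | m + 1 => x m

/-- A sequence is determined by its first letter and its tail. -/
def consSeqEquiv (α : Type*) : α × (ℕ → α) ≃ (ℕ → α) where
  toFun p := consSeq p.1 p.2
  invFun x := (x 0, fun m => x (m + 1))
  left_inv _ := rfl
  right_inv x := by
    funext m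
    cases m <;> rfl

lemma consSeqEquiv_apply {α : Type*} (a : α) (x : ℕ → α) :
    consSeqEquiv α (a, x) = consSeq a x := rfl

lemma consSeq_inj {α : Type*} {a b : α} {x y : ℕ → α} :
    consSeq a x = consSeq b y ↔ a = b ∧ x = y := by
  rw [← consSeqEquiv_apply, ← consSeqEquiv_apply, (consSeqEquiv α).injective.eq_iff,
    Prod.mk.injEq]

/-- The lexicographic order on sequences. -/
def SeqLt {k : ℕ} (x y : ℕ → Fin k) : Prop :=
  ∃ m, (∀ l < m, x l = y l) ∧ x m < y m

lemma SeqLt.asymm {k : ℕ} {x y : ℕ → Fin k} (h : SeqLt x y) : ¬ SeqLt y x := by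
  rintro ⟨m', h1', h2'⟩
  obtain ⟨m, h1, h2⟩ := h
  rcases lt_trichotomy m m' with hm | rfl | hm
  · exact absurd h2 (by rw [h1' m hm]; exact lt_irrefl _)
  · exact lt_asymm h2 h2'
  · exact absurd h2' (by rw [h1 m' hm]; exact lt_irrefl _)

lemma SeqLt.irrefl {k : ℕ} (x : ℕ → Fin k) : ¬ SeqLt x x := fun h => h.asymm h

lemma SeqLt.trichotomy {k : ℕ} {x y : ℕ → Fin k} (h : x ≠ y) : SeqLt x y ∨ SeqLt y x := by
  have hex : ∃ m, x m ≠ y m := Function.ne_iff.mp h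
  classical
  have hmin : ∀ l < Nat.find hex, x l = y l := fun l hl => not_not.mp (Nat.find_min hex hl)
  rcases lt_or_gt_of_ne (Nat.find_spec hex) with h' | h'
  · exact Or.inl ⟨_, hmin, h'⟩
  · exact Or.inr ⟨_, fun l hl => (hmin l hl).symm, h'⟩

lemma seqLt_consSeq {k : ℕ} {a b : Fin k} {x y : ℕ → Fin k} :
    SeqLt (consSeq a x) (consSeq b y) ↔ a < b ∨ a = b ∧ SeqLt x y := by
  constructor
  · rintro ⟨m, h1, h2⟩
    cases m with
    | zero => exact Or.inl h2
    | succ m => exact Or.inr ⟨h1 0 m.succ_pos, m, fun l hl => h1 (l + 1) (by omega), h2⟩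
  · rintro (h | ⟨rfl, m, h1, h2⟩)
    · exact ⟨0, by simp, h⟩
    · refine ⟨m + 1, fun l hl => ?_, h2⟩
      cases l with
      | zero => rfl
      | succ l => exact h1 l (by omega)

/-- The comparisons between sequences used to describe inversions. -/
inductive Cmp
  | any
  | eq
  | lt

namespace Cmp

/-- The relation on sequences attached to a comparison. -/
def Holds {k : ℕ} : Cmp → (ℕ → Fin k) → (ℕ → Fin k) → Prop
  | any, _, _ => True
  | eq, x, y => x = y
  | lt, x, y => SeqLt x y

/-- The parity of the number of pairs of sample sequences satisfying a comparison. -/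
def wt : Cmp → ZMod 2
  | any => 1
  | eq => 1
  | lt => 0

/-- The comparison to be made between the tails of two sequences with given first letters;
`none` means that the comparison fails. -/
def step {k : ℕ} (a b : Fin k) : Cmp → Option Cmp
  | any => some any
  | eq => if a = b then some eq else none
  | lt => if a < b then some any else if a = b then some lt else none

/-- The comparison `lt` is used only over an alphabet with five letters. -/
def Valid (k : ℕ) : Cmp → Prop
  | lt => k = 5
  | _ => k = 3 ∨ k = 5

lemma Valid.step {k : ℕ} {c c' : Cmp} (hc : c.Valid k) {a b : Fin k}
    (h : c.step a b = some c') : c'.Valid k := by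
  cases c <;> simp only [Cmp.step, Option.ite_none_right_eq_some, Option.some.injEq] at h
  · exact h ▸ hc
  · exact h.2 ▸ hc
  · split_ifs at h
    · cases h
      exact Or.inr hc
    · cases h
      exact hc

lemma Valid.eq_or {k : ℕ} {c : Cmp} (hc : c.Valid k) : k = 3 ∨ k = 5 := by
  cases c <;> simp_all [Valid]

lemma holds_consSeq {k : ℕ} {c : Cmp} {a b : Fin k} {x y : ℕ → Fin k} :
    c.Holds (consSeq a x) (consSeq b y) ↔ ∃ c', c.step a b = some c' ∧ c'.Holds x y := by
  cases c with
  | any => simp [Holds, step]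
  | eq =>
    simp only [Holds, step, consSeq_inj]
    split_ifs with h <;> simp [h]
  | lt =>
    simp only [Holds, step, seqLt_consSeq]
    split_ifs with h h' <;> simp [h]
    · simp [h']
    · simp [h']

/-- The contribution of given first letters to the parity of a comparison. -/
def stepWt {k : ℕ} (c : Cmp) (a b : Fin k) : ZMod 2 := (c.step a b).elim 0 wt

lemma sum_stepWt {k : ℕ} {c : Cmp} (hc : c.Valid k) (p q : Bool) :
    ∑ a : Fin k, ∑ b : Fin k,
      (if (p → (a : ℕ) = 0) ∧ (q → (b : ℕ) = 0) then c.stepWt a b else 0) = c.wt := by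
  have hk := hc.eq_or
  cases c with
  | lt =>
    obtain rfl : k = 5 := hc
    revert p q
    decide
  | any =>
    rcases hk with rfl | rfl <;> revert p q <;> decide
  | eq =>
    rcases hk with rfl | rfl <;> revert p q <;> decide

end Cmp

/-- The parity of the number of pairs satisfying a relation. -/
noncomputable def pairCount {X : Type*} (K : X → X → Prop) : ZMod 2 :=
  (Nat.card {p : X × X // K p.1 p.2} : ZMod 2)

lemma pairCount_congr {X : Type*} {K K' : X → X → Prop} (h : ∀ x y, K x y ↔ K' x y) :
    pairCount K = pairCount K' := by
  have : K = K' := by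
    funext x y
    exact propext (h x y)
  rw [this]

lemma pairCount_false {X : Type*} {K : X → X → Prop} (h : ∀ x y, ¬ K x y) :
    pairCount K = 0 := by
  have : IsEmpty {p : X × X // K p.1 p.2} := ⟨fun p => h _ _ p.2⟩
  simp [pairCount]

lemma pairCount_split {X α : Type*} [Fintype α] (e : α × X ≃ X) (K : X → X → Prop)
    [Finite {p : X × X // K p.1 p.2}] :
    pairCount K = ∑ a, ∑ b, pairCount fun x y => K (e (a, x)) (e (b, y)) := by
  let f : (Σ ab : α × α, {p : X × X // K (e (ab.1, p.1)) (e (ab.2, p.2))}) ≃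
      {p : X × X // K p.1 p.2} :=
    { toFun := fun q => ⟨(e (q.1.1, q.2.1.1), e (q.1.2, q.2.1.2)), q.2.2⟩
      invFun := fun p => ⟨((e.symm p.1.1).1, (e.symm p.1.2).1),
        ⟨((e.symm p.1.1).2, (e.symm p.1.2).2), by simpa using p.2⟩⟩
      left_inv := by
        rintro ⟨⟨a, b⟩, ⟨⟨x, y⟩, h⟩⟩
        have h1 := e.symm_apply_apply (a, x)
        have h2 := e.symm_apply_apply (b, y)
        ext <;> simp
      right_inv := by
        rintro ⟨⟨x, y⟩, h⟩
        simp }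
  have hfin : ∀ ab : α × α, Finite {p : X × X // K (e (ab.1, p.1)) (e (ab.2, p.2))} :=
    fun ab => Finite.of_injective (fun p => f ⟨ab, p⟩) fun p q h => by
      simpa using f.injective h
  unfold pairCount
  rw [← Nat.card_congr f, Nat.card_sigma, Fintype.sum_prod_type]
  push_cast
  rfl

/-- The sequences that vanish from position `L` on. -/
def sampleSeq (k L : ℕ) : Set (ℕ → Fin k) := {x | ∀ m, L ≤ m → (x m : ℕ) = 0}

lemma finite_sampleSeq (k L : ℕ) : (sampleSeq k L).Finite := by
  refine Set.Finite.of_finite_image (f := fun x (i : Fin L) => x i) (Set.toFinite _) ?_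
  intro x hx y hy h
  funext m
  by_cases hm : m < L
  · exact congrFun h ⟨m, hm⟩
  · exact Fin.ext ((hx m (not_lt.mp hm)).trans (hy m (not_lt.mp hm)).symm)

lemma consSeq_mem_sampleSeq {k L : ℕ} {a : Fin k} {x : ℕ → Fin k} :
    consSeq a x ∈ sampleSeq k L ↔ (L = 0 → (a : ℕ) = 0) ∧ x ∈ sampleSeq k (L - 1) := by
  constructor
  · intro h
    exact ⟨fun hL => h 0 hL.le, fun m hm => h (m + 1) (by omega)⟩
  · rintro ⟨h1, h2⟩ m hm
    cases m with
    | zero => exact h1 (by omega)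
    | succ m => exact h2 m (by omega)

lemma finite_sampleSeq_pairs (k L L' : ℕ) (K : (ℕ → Fin k) → (ℕ → Fin k) → Prop) :
    Finite {p : (ℕ → Fin k) × (ℕ → Fin k) //
      p.1 ∈ sampleSeq k L ∧ p.2 ∈ sampleSeq k L' ∧ K p.1 p.2} :=
  Set.Finite.subset ((finite_sampleSeq k L).prod (finite_sampleSeq k L'))
    fun _ hp => ⟨hp.1, hp.2.1⟩

lemma pairCount_sampleSeq {k : ℕ} {c : Cmp} (hc : c.Valid k) (L L' : ℕ) :
    pairCount (fun x y => x ∈ sampleSeq k L ∧ y ∈ sampleSeq k L' ∧ c.Holds x y) = c.wt := by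
  obtain ⟨N, hL, hL'⟩ : ∃ N, L ≤ N ∧ L' ≤ N := ⟨max L L', le_max_left _ _, le_max_right _ _⟩
  induction N generalizing L L' c with
  | zero =>
    obtain rfl : L = 0 := by omega
    obtain rfl : L' = 0 := by omega
    have hk : 0 < k := by rcases hc.eq_or with rfl | rfl <;> norm_num
    have hz : ∀ x : ℕ → Fin k, x ∈ sampleSeq k 0 ↔ x = fun _ => ⟨0, hk⟩ := by
      intro x
      simp only [sampleSeq, Set.mem_ofPred_eq, funext_iff, Fin.ext_iff]
      simp
    cases c with
    | lt =>
      refine pairCount_false ?_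
      rintro x y ⟨hx, hy, h⟩
      rw [hz] at hx hy
      subst hx hy
      exact SeqLt.irrefl _ h
    | any =>
      let : Unique {p : (ℕ → Fin k) × (ℕ → Fin k) // p.1 ∈ sampleSeq k 0 ∧
        p.2 ∈ sampleSeq k 0 ∧ Cmp.any.Holds p.1 p.2} :=
        { default := ⟨(fun _ => ⟨0, hk⟩, fun _ => ⟨0, hk⟩), by simp [hz, Cmp.Holds]⟩
          uniq := by
            rintro ⟨⟨x, y⟩, hx, hy, h⟩
            simp only [hz] at hx hy
            simp [hx, hy] }
      simp [pairCount, Cmp.wt]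
    | eq =>
      let : Unique {p : (ℕ → Fin k) × (ℕ → Fin k) // p.1 ∈ sampleSeq k 0 ∧
        p.2 ∈ sampleSeq k 0 ∧ Cmp.eq.Holds p.1 p.2} :=
        { default := ⟨(fun _ => ⟨0, hk⟩, fun _ => ⟨0, hk⟩), by simp [hz, Cmp.Holds]⟩
          uniq := by
            rintro ⟨⟨x, y⟩, hx, hy, h⟩
            simp only [hz] at hx hy
            simp [hx, hy] }
      simp [pairCount, Cmp.wt]
  | succ N ih =>
    have := finite_sampleSeq_pairs k L L' c.Holds
    rw [pairCount_split (consSeqEquiv (Fin k)), ← Cmp.sum_stepWt hc (L = 0) (L' = 0)]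
    refine Finset.sum_congr rfl fun a _ => Finset.sum_congr rfl fun b _ => ?_
    simp only [consSeqEquiv_apply, consSeq_mem_sampleSeq, decide_eq_true_eq,
      Cmp.holds_consSeq]
    split_ifs with h
    · rw [Cmp.stepWt]
      cases hs : c.step a b with
      | none => exact pairCount_false (by simp)
      | some c' =>
        rw [Option.elim_some, ← ih (hc.step hs) (L - 1) (L' - 1) (by omega) (by omega)]
        exact pairCount_congr fun x y => by
          simp only [Option.some.injEq, exists_eq_left']
          tauto
    · exact pairCount_false fun x y hxy => h ⟨hxy.1.1, hxy.2.1.1⟩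

variable {n : ℕ} {k : Fin n → ℕ}

/-- Prepend a letter to one coordinate sequence. -/
def cons (d : Fin n) (a : Fin (k d)) (z : ∀ d, ℕ → Fin (k d)) : ∀ d, ℕ → Fin (k d) :=
  Function.update z d (consSeq a (z d))

/-- Remove the first letter of one coordinate sequence. -/
def tail (d : Fin n) (z : ∀ d, ℕ → Fin (k d)) : ∀ d, ℕ → Fin (k d) :=
  Function.update z d (fun m => z d (m + 1))

lemma cons_self (d : Fin n) (a : Fin (k d)) (z : ∀ d, ℕ → Fin (k d)) :
    cons d a z d = consSeq a (z d) := by simp [cons]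

lemma cons_of_ne {d e : Fin n} (h : e ≠ d) (a : Fin (k d)) (z : ∀ d, ℕ → Fin (k d)) :
    cons d a z e = z e := by simp [cons, h]

lemma tail_cons (d : Fin n) (a : Fin (k d)) (z : ∀ d, ℕ → Fin (k d)) :
    tail d (cons d a z) = z := by
  simp [tail, cons, consSeq]

lemma cons_tail (d : Fin n) (z : ∀ d, ℕ → Fin (k d)) : cons d (z d 0) (tail d z) = z := by
  have := (consSeqEquiv (Fin (k d))).apply_symm_apply (z d)
  simp only [cons, tail, Function.update_self, Function.update_idem]
  exact Function.update_eq_self_iff.mpr this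

lemma cons_comm {d e : Fin n} (h : e ≠ d) (a : Fin (k d)) (b : Fin (k e))
    (z : ∀ d, ℕ → Fin (k d)) : cons e b (cons d a z) = cons d a (cons e b z) := by
  simp only [cons, Function.update_of_ne h, Function.update_of_ne h.symm]
  exact Function.update_comm h.symm _ _ _

/-- A point is determined by the first letter of one coordinate and the remaining letters. -/
def consEquiv (d : Fin n) :
    Fin (k d) × (∀ d, ℕ → Fin (k d)) ≃ (∀ d, ℕ → Fin (k d)) where
  toFun p := cons d p.1 p.2
  invFun z := (z d 0, tail d z)
  left_inv := by
    rintro ⟨a, z⟩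
    simp [tail_cons, cons_self, consSeq]
  right_inv z := cons_tail d z

lemma consEquiv_apply (d : Fin n) (a : Fin (k d)) (z : ∀ d, ℕ → Fin (k d)) :
    consEquiv d (a, z) = cons d a z := rfl

/-- The embeddings of the standard bricks. -/
inductive Brick : ((∀ d, ℕ → Fin (k d)) → Sp n k) → Prop
  | root (j : ℕ) : Brick (fun z => (z, j))
  | cons {β} (d : Fin n) (a : Fin (k d)) : Brick β → Brick (fun z => β (cons d a z))

/-- The maps that become embeddings of standard bricks after subdividing the domain
finitely often. -/
inductive PiecewiseBrick : ((∀ d, ℕ → Fin (k d)) → Sp n k) → Prop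
  | of {β} : Brick β → PiecewiseBrick β
  | split {β} (d : Fin n) :
      (∀ a, PiecewiseBrick (fun z => β (WGroup.cons d a z))) → PiecewiseBrick β

namespace PiecewiseBrick

lemma root (j : ℕ) : PiecewiseBrick (fun z => ((z, j) : Sp n k)) := of (.root j)

lemma cons {β : (∀ d, ℕ → Fin (k d)) → Sp n k} (h : PiecewiseBrick β) (e : Fin n)
    (b : Fin (k e)) : PiecewiseBrick (fun z => β (WGroup.cons e b z)) := by
  induction h with
  | of h => exact of (h.cons e b)
  | @split β d h ih =>
    by_cases hed : e = d
    · subst hed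
      exact h b
    · refine split d fun a => ?_
      simpa only [cons_comm hed] using ih a

lemma comp {β : (∀ d, ℕ → Fin (k d)) → Sp n k} (h : PiecewiseBrick β)
    {g : Equiv.Perm (Sp n k)} (hg : ∀ j, PiecewiseBrick (fun z => g (z, j))) :
    PiecewiseBrick (fun z => g (β z)) := by
  induction h with
  | of h =>
    induction h with
    | root j => exact hg j
    | cons d a _ ih => exact ih.cons d a
  | split d _ ih => exact split d ih

end PiecewiseBrick

lemma piecewiseBrick_of_tMap {i : ℕ} {g : Equiv.Perm (Sp n k)} (hg : ∀ p, g p = tMap k i p)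
    (j : ℕ) : PiecewiseBrick (fun z => g (z, j)) := by
  simp only [hg, tMap]
  split_ifs <;> exact .root _

lemma piecewiseBrick_symm_of_tMap {i : ℕ} {g : Equiv.Perm (Sp n k)}
    (hg : ∀ p, g p = tMap k i p) (j : ℕ) :
    PiecewiseBrick (fun z => g.symm (z, j)) := by
  have : g.symm = g := by
    ext1 p
    rw [Equiv.symm_apply_eq, hg, hg]
    unfold tMap
    split_ifs <;> simp_all <;> ext <;> simp_all
  rw [this]
  exact piecewiseBrick_of_tMap hg j

lemma sMap_root_cons (i : ℕ) (d : Fin n) (a : Fin (k d)) (z : ∀ d, ℕ → Fin (k d)) :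
    sMap k i d (cons d a z, i) = (z, i + a) := by
  have := tail_cons d a z
  unfold tail at this
  simpa [sMap, cons_self, consSeq] using this

lemma piecewiseBrick_of_sMap {i : ℕ} {d : Fin n} {g : Equiv.Perm (Sp n k)}
    (hg : ∀ p, g p = sMap k i d p) (j : ℕ) : PiecewiseBrick (fun z => g (z, j)) := by
  rcases lt_trichotomy j i with h | rfl | h
  · simpa [hg, sMap, h] using PiecewiseBrick.root j
  · refine .split d fun a => ?_
    simpa only [hg, sMap_root_cons] using PiecewiseBrick.root _
  · simpa [hg, sMap, h.not_gt, h.ne'] using PiecewiseBrick.root _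

lemma piecewiseBrick_symm_of_sMap {i : ℕ} {d : Fin n} {g : Equiv.Perm (Sp n k)}
    (hg : ∀ p, g p = sMap k i d p) (j : ℕ) : PiecewiseBrick (fun z => g.symm (z, j)) := by
  by_cases h : j < i
  · have : ∀ z, g.symm (z, j) = (z, j) := fun z => by
      rw [Equiv.symm_apply_eq, hg]
      simp [sMap, h]
    simpa only [this] using PiecewiseBrick.root j
  by_cases h' : j < i + k d
  · have : ∀ z, g.symm (z, j) = (cons d ⟨j - i, by omega⟩ z, i) := fun z => by
      rw [Equiv.symm_apply_eq, hg, sMap_root_cons]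
      ext1
      · rfl
      · dsimp only
        omega
    simp only [this]
    exact (PiecewiseBrick.root i).cons d _
  · by_cases hk : k d = 0
    · exact .split d fun a => absurd a.2 (by omega)
    have : ∀ z, g.symm (z, j) = (z, j - (k d - 1)) := fun z => by
      rw [Equiv.symm_apply_eq, hg]
      have h1 : ¬ j - (k d - 1) < i := by omega
      have h2 : j - (k d - 1) ≠ i := by omega
      simp only [sMap, h1, h2, if_false]
      ext1
      · rfl
      · dsimp only
        omega
    simpa only [this] using PiecewiseBrick.root _

lemma PiecewiseBrick.comp_of_mem_closure {s : ℕ → Fin n → Equiv.Perm (Sp n k)}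
    {t : ℕ → Equiv.Perm (Sp n k)} (hs : ∀ i d p, s i d p = sMap k i d p)
    (ht : ∀ i p, t i p = tMap k i p) {g : Equiv.Perm (Sp n k)}
    (hg : g ∈ Subgroup.closure (gens k s t)) {β : (∀ d, ℕ → Fin (k d)) → Sp n k}
    (hβ : PiecewiseBrick β) :
    PiecewiseBrick (fun z => g (β z)) ∧ PiecewiseBrick (fun z => g.symm (β z)) := by
  induction hg using Subgroup.closure_induction generalizing β with
  | mem g hg =>
    rcases hg with ⟨i, d, rfl⟩ | ⟨i, rfl⟩
    · exact ⟨hβ.comp (piecewiseBrick_of_sMap (hs i d)),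
        hβ.comp (piecewiseBrick_symm_of_sMap (hs i d))⟩
    · exact ⟨hβ.comp (piecewiseBrick_of_tMap (ht i)),
        hβ.comp (piecewiseBrick_symm_of_tMap (ht i))⟩
  | one => exact ⟨hβ, hβ⟩
  | mul g h _ _ ihg ihh => exact ⟨(ihg (ihh hβ).1).1, (ihh (ihg hβ).2).2⟩
  | inv g _ ih => exact ⟨(ih hβ).2, (ih hβ).1⟩

/-- The points in the first `M` copies all of whose letters vanish from position `M` on. -/
def sample (k : Fin n → ℕ) (M : ℕ) : Set (Sp n k) :=
  {p | (∀ d, p.1 d ∈ sampleSeq (k d) M) ∧ p.2 < M}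

lemma finite_sample (k : Fin n → ℕ) (M : ℕ) : (sample k M).Finite := by
  refine ((Set.Finite.pi (t := fun d => sampleSeq (k d) M) fun d =>
    finite_sampleSeq (k d) M).prod (Set.finite_Iio M)).subset fun p hp => ?_
  exact ⟨fun d _ => hp.1 d, hp.2⟩

lemma Brick.exists_sample {β : (∀ d, ℕ → Fin (k d)) → Sp n k} (h : Brick β) :
    ∃ L : Fin n → ℕ, ∀ᶠ M in Filter.atTop, ∀ z,
      β z ∈ sample k M ↔ ∀ d, z d ∈ sampleSeq (k d) (M - L d) := by
  induction h with
  | root j =>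
    refine ⟨0, ?_⟩
    filter_upwards [Filter.eventually_gt_atTop j] with M hM z
    simp [sample, hM]
  | cons d a _ ih =>
    obtain ⟨L, hL⟩ := ih
    refine ⟨Function.update L d (L d + 1), ?_⟩
    filter_upwards [hL, Filter.eventually_gt_atTop (L d)] with M h hM z
    rw [h]
    refine forall_congr' fun e => ?_
    by_cases hed : e = d
    · subst hed
      rw [cons_self, consSeq_mem_sampleSeq, Function.update_self, Nat.sub_add_eq]
      exact and_iff_right fun h0 => by omega
    · rw [cons_of_ne hed, Function.update_of_ne hed]

lemma PiecewiseBrick.finite_preimage {β : (∀ d, ℕ → Fin (k d)) → Sp n k}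
    (h : PiecewiseBrick β) {S : Set (Sp n k)} (hS : S.Finite) : (β ⁻¹' S).Finite := by
  induction h with
  | of h =>
    refine hS.preimage (Function.Injective.injOn ?_)
    induction h with
    | root j => exact fun x y h => congrArg Prod.fst h
    | cons d a _ ih =>
      exact fun x y h => by simpa [tail_cons] using congrArg (tail d) (ih h)
  | @split β d _ ih =>
    refine (Set.finite_iUnion fun a => (ih a).image (WGroup.cons d a)).subset fun z hz => ?_
    refine Set.mem_iUnion.mpr ⟨z d 0, tail d z, ?_, cons_tail d z⟩
    simpa [cons_tail] using hz

lemma pairCount_pi_sampleSeq {c : Fin n → Cmp} (hc : ∀ d, (c d).Valid (k d))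
    (L L' : Fin n → ℕ) :
    pairCount (fun x y : ∀ d, ℕ → Fin (k d) => (∀ d, x d ∈ sampleSeq (k d) (L d)) ∧
      (∀ d, y d ∈ sampleSeq (k d) (L' d)) ∧ ∀ d, (c d).Holds (x d) (y d)) =
      ∏ d, (c d).wt := by
  let f : {p : (∀ d, ℕ → Fin (k d)) × (∀ d, ℕ → Fin (k d)) //
      (∀ d, p.1 d ∈ sampleSeq (k d) (L d)) ∧ (∀ d, p.2 d ∈ sampleSeq (k d) (L' d)) ∧
        ∀ d, (c d).Holds (p.1 d) (p.2 d)} ≃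
      ∀ d, {q : (ℕ → Fin (k d)) × (ℕ → Fin (k d)) // q.1 ∈ sampleSeq (k d) (L d) ∧
        q.2 ∈ sampleSeq (k d) (L' d) ∧ (c d).Holds q.1 q.2} :=
    { toFun := fun p d => ⟨(p.1.1 d, p.1.2 d), p.2.1 d, p.2.2.1 d, p.2.2.2 d⟩
      invFun := fun q => ⟨(fun d => (q d).1.1, fun d => (q d).1.2),
        fun d => (q d).2.1, fun d => (q d).2.2.1, fun d => (q d).2.2.2⟩
      left_inv := fun _ => rfl
      right_inv := fun _ => rfl }
  rw [pairCount, Nat.card_congr f, Nat.card_pi]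
  push_cast
  exact Finset.prod_congr rfl fun d _ => pairCount_sampleSeq (hc d) (L d) (L' d)

/-- Two maps are balanced if the sample points they hit satisfy every admissible family of
comparisons as often, modulo two, as in the product of the one-coordinate counts. -/
def Balanced (β β' : (∀ d, ℕ → Fin (k d)) → Sp n k) : Prop :=
  ∀ c : Fin n → Cmp, (∀ d, (c d).Valid (k d)) → ∀ᶠ M in Filter.atTop,
    pairCount (fun x y => β x ∈ sample k M ∧ β' y ∈ sample k M ∧
      ∀ d, (c d).Holds (x d) (y d)) = ∏ d, (c d).wt

lemma Brick.balanced {β β' : (∀ d, ℕ → Fin (k d)) → Sp n k} (h : Brick β) (h' : Brick β') :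
    Balanced β β' := by
  intro c hc
  obtain ⟨L, hL⟩ := h.exists_sample
  obtain ⟨L', hL'⟩ := h'.exists_sample
  filter_upwards [hL, hL'] with M hM hM'
  simp only [hM, hM']
  exact pairCount_pi_sampleSeq hc _ _

lemma holds_cons {c : Fin n → Cmp} {d : Fin n} {a b : Fin (k d)}
    {x y : ∀ d, ℕ → Fin (k d)} :
    (∀ e, (c e).Holds (cons d a x e) (cons d b y e)) ↔
      ∃ c', (c d).step a b = some c' ∧ ∀ e, (Function.update c d c' e).Holds (x e) (y e) := by
  constructor
  · intro h
    have hd := h d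
    rw [cons_self, cons_self, Cmp.holds_consSeq] at hd
    obtain ⟨c', h1, h2⟩ := hd
    refine ⟨c', h1, fun e => ?_⟩
    by_cases hed : e = d
    · subst hed
      simpa using h2
    · simpa [hed, cons_of_ne hed] using h e
  · rintro ⟨c', h1, h2⟩ e
    by_cases hed : e = d
    · subst hed
      rw [cons_self, cons_self, Cmp.holds_consSeq]
      exact ⟨c', h1, by simpa using h2 e⟩
    · simpa [hed, cons_of_ne hed] using h2 e

lemma PiecewiseBrick.balanced_of_split {β β' : (∀ d, ℕ → Fin (k d)) → Sp n k}
    (hβ : PiecewiseBrick β) (hβ' : PiecewiseBrick β') (d : Fin n)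
    (h : ∀ a b, Balanced (fun z => β (WGroup.cons d a z)) (fun z => β' (WGroup.cons d b z))) :
    Balanced β β' := by
  intro c hc
  have key : ∀ a b : Fin (k d), ∀ᶠ M in Filter.atTop,
      pairCount (fun x y => β (WGroup.cons d a x) ∈ sample k M ∧
        β' (WGroup.cons d b y) ∈ sample k M ∧
        ∀ e, (c e).Holds (WGroup.cons d a x e) (WGroup.cons d b y e)) =
      (c d).stepWt a b * ∏ e ∈ Finset.univ.erase d, (c e).wt := by
    intro a b
    simp only [holds_cons, Cmp.stepWt]
    cases hs : (c d).step a b with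
    | none => exact .of_forall fun M => by simp [pairCount_false]
    | some c' =>
      filter_upwards [h a b (Function.update c d c') fun e => by
        by_cases hed : e = d
        · subst hed
          simpa using (hc e).step hs
        · simpa [hed] using hc e] with M hM
      simp only [Option.some.injEq, exists_eq_left', hM, Option.elim_some]
      rw [← Finset.mul_prod_erase _ _ (Finset.mem_univ d), Function.update_self]
      congr 1
      exact Finset.prod_congr rfl fun e he => by
        rw [Function.update_of_ne (Finset.ne_of_mem_erase he)]
  filter_upwards [Filter.eventually_all.mpr fun a => Filter.eventually_all.mpr (key a)]
    with M hM
  have : Finite {p : (∀ d, ℕ → Fin (k d)) × (∀ d, ℕ → Fin (k d)) // β p.1 ∈ sample k M ∧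
      β' p.2 ∈ sample k M ∧ ∀ d, (c d).Holds (p.1 d) (p.2 d)} :=
    Set.Finite.subset ((hβ.finite_preimage (finite_sample k M)).prod
      (hβ'.finite_preimage (finite_sample k M))) fun _ hp => ⟨hp.1, hp.2.1⟩
  rw [pairCount_split (consEquiv d)]
  simp only [consEquiv_apply, hM]
  rw [← Finset.mul_prod_erase _ _ (Finset.mem_univ d), ← Cmp.sum_stepWt (hc d) false false]
  simp [Finset.sum_mul]

lemma PiecewiseBrick.balanced {β β' : (∀ d, ℕ → Fin (k d)) → Sp n k}
    (hβ : PiecewiseBrick β) (hβ' : PiecewiseBrick β') : Balanced β β' := by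
  induction hβ generalizing β' with
  | @of β h =>
    induction hβ' generalizing β with
    | of h' => exact h.balanced h'
    | split d h' ih =>
      exact (PiecewiseBrick.of h).balanced_of_split (.split d h') d fun a b => ih b (h.cons d a)
  | split d h ih =>
    exact (PiecewiseBrick.split d h).balanced_of_split hβ' d fun a b => ih a (hβ'.cons d b)

/-- The position of a coordinate in the order of comparison: coordinate `0` comes last. -/
def rank (e : Fin n) : ℕ := if (e : ℕ) = 0 then n else e

lemma rank_le (e : Fin n) : rank e ≤ n := by
  unfold rank
  split_ifs <;> omega

lemma rank_injective : Function.Injective (rank : Fin n → ℕ) := by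
  intro e e' h
  unfold rank at h
  ext
  split_ifs at h <;> omega

/-- `e` is the first coordinate in which `z` and `w` differ, and `z` is smaller there. -/
def FirstLt (e : Fin n) (z w : ∀ d, ℕ → Fin (k d)) : Prop :=
  (∀ e', rank e' < rank e → z e' = w e') ∧ SeqLt (z e) (w e)

/-- The comparisons expressing `FirstLt`. -/
def firstCmp (e e' : Fin n) : Cmp :=
  if rank e' < rank e then .eq else if e' = e then .lt else .any

lemma holds_firstCmp {e : Fin n} {z w : ∀ d, ℕ → Fin (k d)} :
    (∀ e', (firstCmp e e').Holds (z e') (w e')) ↔ FirstLt e z w := by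
  constructor
  · intro h
    refine ⟨fun e' he' => ?_, ?_⟩
    · simpa [firstCmp, he', Cmp.Holds] using h e'
    · simpa [firstCmp, Cmp.Holds] using h e
  · rintro ⟨h1, h2⟩ e'
    unfold firstCmp
    split_ifs with h h'
    · exact h1 e' h
    · exact h' ▸ h2
    · trivial

lemma prod_wt_firstCmp (e : Fin n) : ∏ e', (firstCmp e e').wt = 0 :=
  Finset.prod_eq_zero (Finset.mem_univ e) (by simp [firstCmp, Cmp.wt])

lemma FirstLt.unique {e e' : Fin n} {z w : ∀ d, ℕ → Fin (k d)} (h : FirstLt e z w)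
    (h' : FirstLt e' z w) : e = e' := by
  rcases lt_trichotomy (rank e) (rank e') with hr | hr | hr
  · exact absurd (h'.1 e hr ▸ h.2) (SeqLt.irrefl _)
  · exact rank_injective hr
  · exact absurd (h.1 e' hr ▸ h'.2) (SeqLt.irrefl _)

lemma firstLt_cons_of_lt {d e : Fin n} {a b : Fin (k d)} (hba : b < a)
    {z w : ∀ d, ℕ → Fin (k d)} :
    FirstLt e (cons d a z) (cons d b w) ↔ rank e < rank d ∧ FirstLt e z w := by
  constructor
  · rintro ⟨h1, h2⟩
    have hed : rank e < rank d := by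
      rcases lt_trichotomy (rank e) (rank d) with hr | hr | hr
      · exact hr
      · obtain rfl := rank_injective hr
        rw [cons_self, cons_self, seqLt_consSeq] at h2
        rcases h2 with h2 | ⟨h2, -⟩
        · exact absurd h2 hba.not_gt
        · exact absurd h2 hba.ne'
      · have := h1 d hr
        rw [cons_self, cons_self, consSeq_inj] at this
        exact absurd this.1 hba.ne'
    have hne : ∀ e', rank e' < rank d → e' ≠ d := fun e' h h' => by simp [h'] at h
    refine ⟨hed, fun e' he' => ?_, ?_⟩
    · simpa only [cons_of_ne (hne e' (he'.trans hed))] using h1 e' he'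
    · simpa only [cons_of_ne (hne e hed)] using h2
  · rintro ⟨hed, h1, h2⟩
    have hne : ∀ e', rank e' < rank d → e' ≠ d := fun e' h h' => by simp [h'] at h
    refine ⟨fun e' he' => ?_, ?_⟩
    · simpa only [cons_of_ne (hne e' (he'.trans hed))] using h1 e' he'
    · simpa only [cons_of_ne (hne e hed)] using h2

lemma firstLt_cons_self {d e : Fin n} {a : Fin (k d)} {z w : ∀ d, ℕ → Fin (k d)} :
    FirstLt e (cons d a z) (cons d a w) ↔ FirstLt e z w := by
  refine and_congr (forall₂_congr fun e' _ => ?_) ?_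
  · by_cases h : e' = d
    · subst h
      simp [cons_self, consSeq_inj]
    · simp [cons_of_ne h]
  · by_cases h : e = d
    · subst h
      simp [cons_self, seqLt_consSeq]
    · simp [cons_of_ne h]

/-- The lexicographic order on `Z(n,k)`, comparing coordinate `0` last. -/
def ZLt (z w : ∀ d, ℕ → Fin (k d)) : Prop := ∃ e, FirstLt e z w

lemma ZLt.asymm {z w : ∀ d, ℕ → Fin (k d)} (h : ZLt z w) : ¬ ZLt w z := by
  rintro ⟨e', h'⟩
  obtain ⟨e, h⟩ := h
  rcases lt_trichotomy (rank e) (rank e') with hr | hr | hr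
  · exact SeqLt.irrefl _ (h'.1 e hr ▸ h.2)
  · obtain rfl := rank_injective hr
    exact h.2.asymm h'.2
  · exact SeqLt.irrefl _ (h.1 e' hr ▸ h'.2)

lemma ZLt.trichotomy {z w : ∀ d, ℕ → Fin (k d)} (h : z ≠ w) : ZLt z w ∨ ZLt w z := by
  classical
  obtain ⟨e₀, h₀⟩ := Function.ne_iff.mp h
  obtain ⟨e, he, hmin⟩ := Finset.exists_min_image (Finset.univ.filter fun e => z e ≠ w e) rank
    ⟨e₀, by simpa using h₀⟩
  have heq : ∀ e', rank e' < rank e → z e' = w e' := fun e' he' => by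
    by_contra hne
    exact absurd (hmin e' (by simpa using hne)) he'.not_ge
  rcases SeqLt.trichotomy (Finset.mem_filter.mp he).2 with h' | h'
  · exact Or.inl ⟨e, heq, h'⟩
  · exact Or.inr ⟨e, fun e' he' => (heq e' he').symm, h'⟩

/-- The total order on `Z(n,k) × ℕ` used to count inversions. -/
def SpLt (p q : Sp n k) : Prop := p.2 < q.2 ∨ p.2 = q.2 ∧ ZLt p.1 q.1

lemma SpLt.asymm {p q : Sp n k} (h : SpLt p q) : ¬ SpLt q p := by
  rintro (h' | ⟨h1', h2'⟩) <;> rcases h with h | ⟨h1, h2⟩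
  · omega
  · omega
  · omega
  · exact h2.asymm h2'

lemma SpLt.trichotomy {p q : Sp n k} (h : p ≠ q) : SpLt p q ∨ SpLt q p := by
  rcases lt_trichotomy p.2 q.2 with h' | h' | h'
  · exact Or.inl (Or.inl h')
  · rcases ZLt.trichotomy (fun h1 => h (Prod.ext h1 h')) with h1 | h1
    · exact Or.inl (Or.inr ⟨h', h1⟩)
    · exact Or.inr (Or.inr ⟨h'.symm, h1⟩)
  · exact Or.inr (Or.inl h')

open Classical in
/-- The indicator function of the order. -/
noncomputable def ltInd (p q : Sp n k) : ZMod 2 := if SpLt p q then 1 else 0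

lemma ltInd_self (p : Sp n k) : ltInd p p = 0 := if_neg fun h => h.asymm h

lemma ltInd_swap {p q : Sp n k} (h : p ≠ q) : ltInd q p = ltInd p q + 1 := by
  unfold ltInd
  rcases SpLt.trichotomy h with h' | h' <;> simp only [h', h'.asymm, if_true, if_false] <;> decide

/-- The parity of the number of pairs of points of `D` whose order is reversed by `g`. -/
noncomputable def inversions (g : Equiv.Perm (Sp n k)) (D : Finset (Sp n k)) : ZMod 2 :=
  ∑ p ∈ D, ∑ q ∈ D, ltInd p q * (ltInd p q + ltInd (g p) (g q))

lemma sum_symm_eq_zero {X : Type*} (D : Finset X) (F : X → X → ZMod 2)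
    (hF : ∀ p q, F p q = F q p) (hF' : ∀ p, F p p = 0) : ∑ p ∈ D, ∑ q ∈ D, F p q = 0 := by
  rw [← Finset.sum_product']
  refine Finset.sum_involution (fun x _ => x.swap) ?_ ?_ ?_ ?_
  · rintro ⟨p, q⟩ -
    simp only [Prod.swap]
    rw [hF q p, CharTwo.add_self_eq_zero]
  · rintro ⟨p, q⟩ - h h'
    obtain rfl : q = p := congrArg Prod.fst h'
    exact h (hF' q)
  · rintro ⟨p, q⟩ h
    simpa [and_comm] using h
  · rintro ⟨p, q⟩ -
    rfl

lemma inversions_mul (g h : Equiv.Perm (Sp n k)) (D : Finset (Sp n k)) :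
    inversions (g * h) D = inversions h D + inversions g (D.map h.toEmbedding) := by
  have hsum : ∑ p ∈ D, ∑ q ∈ D, (ltInd p q + ltInd (h p) (h q)) *
      (ltInd (h p) (h q) + ltInd (g (h p)) (g (h q))) = 0 := by
    refine sum_symm_eq_zero D _ (fun p q => ?_) fun p => by simp [ltInd_self]
    by_cases hpq : p = q
    · rw [hpq]
    · rw [ltInd_swap hpq, ltInd_swap (h.injective.ne hpq),
        ltInd_swap (g.injective.ne (h.injective.ne hpq))]
      generalize ltInd p q = a
      generalize ltInd (h p) (h q) = b
      generalize ltInd (g (h p)) (g (h q)) = c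
      revert a b c
      decide
  rw [← add_zero (inversions (g * h) D), ← hsum]
  simp only [inversions, Finset.sum_map, ← Finset.sum_add_distrib]
  refine Finset.sum_congr rfl fun p _ => Finset.sum_congr rfl fun q _ => ?_
  simp only [Equiv.Perm.mul_apply, Equiv.coe_toEmbedding]
  generalize ltInd p q = a
  generalize ltInd (h p) (h q) = b
  generalize ltInd (g (h p)) (g (h q)) = c
  revert a b c
  decide

lemma inversions_one (D : Finset (Sp n k)) : inversions 1 D = 0 := by
  simp [inversions, CharTwo.add_self_eq_zero]

lemma inversions_eq_pairCount {g : Equiv.Perm (Sp n k)} {i j : ℕ}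
    {K : (∀ d, ℕ → Fin (k d)) → (∀ d, ℕ → Fin (k d)) → Prop}
    (h : ∀ p q, SpLt p q ∧ ¬ SpLt (g p) (g q) ↔ p.2 = i ∧ q.2 = j ∧ K p.1 q.1)
    (D : Finset (Sp n k)) :
    inversions g D = pairCount fun z w => (z, i) ∈ D ∧ (w, j) ∈ D ∧ K z w := by
  classical
  have hterm : ∀ p q, ltInd p q * (ltInd p q + ltInd (g p) (g q)) =
      if p.2 = i ∧ q.2 = j ∧ K p.1 q.1 then 1 else 0 := by
    intro p q
    rw [← if_congr (h p q) rfl rfl]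
    unfold ltInd
    by_cases h1 : SpLt p q <;> by_cases h2 : SpLt (g p) (g q) <;>
      simp [h1, h2, CharTwo.add_self_eq_zero]
  let f : {p : (∀ d, ℕ → Fin (k d)) × (∀ d, ℕ → Fin (k d)) //
      (p.1, i) ∈ D ∧ (p.2, j) ∈ D ∧ K p.1 p.2} ≃
      {x // x ∈ (D ×ˢ D).filter fun x => x.1.2 = i ∧ x.2.2 = j ∧ K x.1.1 x.2.1} :=
    { toFun := fun p => ⟨((p.1.1, i), (p.1.2, j)), by simpa [and_assoc] using p.2⟩
      invFun := fun x => ⟨(x.1.1.1, x.1.2.1), by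
        obtain ⟨⟨⟨z, a⟩, ⟨w, b⟩⟩, hx⟩ := x
        simp only [Finset.mem_filter, Finset.mem_product] at hx
        obtain ⟨⟨h1, h2⟩, rfl, rfl, h3⟩ := hx
        exact ⟨h1, h2, h3⟩⟩
      left_inv := fun _ => rfl
      right_inv := by
        rintro ⟨⟨⟨z, a⟩, ⟨w, b⟩⟩, hx⟩
        simp only [Finset.mem_filter] at hx
        obtain ⟨-, rfl, rfl, -⟩ := hx
        rfl }
  simp only [inversions, hterm]
  rw [← Finset.sum_product', Finset.sum_boole, pairCount, Nat.card_congr f,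
    Nat.card_eq_fintype_card, Fintype.card_coe]

lemma inversion_tMap {i : ℕ} {g : Equiv.Perm (Sp n k)} (hg : ∀ p, g p = tMap k i p)
    (p q : Sp n k) :
    SpLt p q ∧ ¬ SpLt (g p) (g q) ↔ p.2 = i ∧ q.2 = i + 1 ∧ True := by
  obtain ⟨z, a⟩ := p
  obtain ⟨w, b⟩ := q
  simp only [hg, tMap, SpLt]
  grind

lemma inversion_sMap {i : ℕ} {d : Fin n} {g : Equiv.Perm (Sp n k)}
    (hg : ∀ p, g p = sMap k i d p) (p q : Sp n k) :
    SpLt p q ∧ ¬ SpLt (g p) (g q) ↔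
      p.2 = i ∧ q.2 = i ∧ q.1 d 0 < p.1 d 0 ∧ ZLt p.1 q.1 := by
  obtain ⟨z, j⟩ := p
  obtain ⟨w, l⟩ := q
  rw [hg, hg]
  by_cases hjl : j = i ∧ l = i
  · obtain ⟨rfl, rfl⟩ := hjl
    obtain ⟨a, z, rfl⟩ : ∃ a z', z = cons d a z' := ⟨_, _, (cons_tail d z).symm⟩
    obtain ⟨b, w, rfl⟩ : ∃ b w', w = cons d b w' := ⟨_, _, (cons_tail d w).symm⟩
    simp only [sMap_root_cons, cons_self, consSeq, SpLt, lt_irrefl, false_or, true_and]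
    rcases lt_trichotomy a b with hab | rfl | hab
    · simp [hab.not_gt, hab]
    · simp [ZLt, firstLt_cons_self]
    · have h1 : ¬ (a : ℕ) < b := hab.not_gt
      have h2 : (a : ℕ) ≠ b := fun h => hab.ne' (Fin.ext h)
      simp [h1, h2, hab]
  · have hz := (z d 0).isLt
    have hw := (w d 0).isLt
    simp only [sMap, SpLt]
    grind

lemma pairCount_exists {X ι : Type*} [Fintype ι] {K : ι → X → X → Prop}
    (hK : ∀ {i j x y}, K i x y → K j x y → i = j) [∀ i, Finite {p : X × X // K i p.1 p.2}] :
    pairCount (fun x y => ∃ i, K i x y) = ∑ i, pairCount (K i) := by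
  let f : (Σ i, {p : X × X // K i p.1 p.2}) → {p : X × X // ∃ i, K i p.1 p.2} :=
    fun q => ⟨q.2.1, q.1, q.2.2⟩
  have hf : Function.Bijective f := by
    refine ⟨?_, fun ⟨p, i, hp⟩ => ⟨⟨i, p, hp⟩, rfl⟩⟩
    rintro ⟨i, p, hp⟩ ⟨j, q, hq⟩ h
    obtain rfl : p = q := congrArg Subtype.val h
    obtain rfl := hK hp hq
    rfl
  unfold pairCount
  rw [← Nat.card_eq_of_bijective f hf, Nat.card_sigma]
  push_cast
  rfl

/-- The image under `h` of the sample points. -/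
noncomputable def sampleImage (h : Equiv.Perm (Sp n k)) (M : ℕ) : Finset (Sp n k) :=
  (finite_sample k M).toFinset.map h.toEmbedding

lemma mem_sampleImage {h : Equiv.Perm (Sp n k)} {M : ℕ} {p : Sp n k} :
    p ∈ sampleImage h M ↔ h.symm p ∈ sample k M := by
  rw [sampleImage, Finset.mem_map_equiv, Set.Finite.mem_toFinset]

lemma sampleImage_map (g h : Equiv.Perm (Sp n k)) (M : ℕ) :
    (sampleImage h M).map g.toEmbedding = sampleImage (g * h) M := by
  rw [sampleImage, Finset.map_map]
  rfl

lemma inversions_tMap_eventually {i : ℕ} {g : Equiv.Perm (Sp n k)}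
    (hk : ∀ d, k d = 3 ∨ k d = 5)
    (hg : ∀ p, g p = tMap k i p) {h : Equiv.Perm (Sp n k)}
    (hh : ∀ j, PiecewiseBrick (fun z => h.symm (z, j))) :
    ∀ᶠ M in Filter.atTop, inversions g (sampleImage h M) = 1 := by
  filter_upwards [(hh i).balanced (hh (i + 1)) (fun _ => .any) hk] with M hM
  rw [inversions_eq_pairCount (K := fun _ _ => True) (inversion_tMap hg)]
  simpa [mem_sampleImage, Cmp.Holds, Cmp.wt] using hM

lemma inversions_sMap_eventually {i : ℕ} {d : Fin n} {g : Equiv.Perm (Sp n k)}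
    (hk : ∀ d, k d = 3 ∨ k d = 5) (hk' : ∀ d : Fin n, (d : ℕ) ≠ 0 → k d = 5)
    (hg : ∀ p, g p = sMap k i d p) {h : Equiv.Perm (Sp n k)}
    (hh : ∀ j, PiecewiseBrick (fun z => h.symm (z, j))) :
    ∀ᶠ M in Filter.atTop, inversions g (sampleImage h M) = 0 := by
  have key : ∀ (a b : Fin (k d)) (e : Fin n), ∀ᶠ M in Filter.atTop, rank e < rank d →
      pairCount (fun z w => h.symm (cons d a z, i) ∈ sample k M ∧
        h.symm (cons d b w, i) ∈ sample k M ∧ FirstLt e z w) = 0 := by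
    intro a b e
    by_cases he : rank e < rank d
    · have hvalid : ∀ e', (firstCmp e e').Valid (k e') := by
        intro e'
        unfold firstCmp
        split_ifs with h1 h2
        · exact hk e'
        · subst h2
          refine hk' e' fun h0 => ?_
          have := rank_le d
          have : rank e' = n := if_pos h0
          omega
        · exact hk e'
      filter_upwards [((hh i).cons d a).balanced ((hh i).cons d b) _ hvalid] with M hM _
      simpa only [holds_firstCmp, prod_wt_firstCmp] using hM
    · exact .of_forall fun M he' => absurd he' he
  filter_upwards [Filter.eventually_all.mpr fun a => Filter.eventually_all.mpr fun b =>
    Filter.eventually_all.mpr (key a b)] with M hM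
  have hfin : ∀ {β β' : (∀ d, ℕ → Fin (k d)) → Sp n k}, PiecewiseBrick β → PiecewiseBrick β' →
      ∀ K : (∀ d, ℕ → Fin (k d)) → (∀ d, ℕ → Fin (k d)) → Prop,
      Finite {p : (∀ d, ℕ → Fin (k d)) × (∀ d, ℕ → Fin (k d)) //
        β p.1 ∈ sample k M ∧ β' p.2 ∈ sample k M ∧ K p.1 p.2} := fun hβ hβ' K =>
    Set.Finite.subset ((hβ.finite_preimage (finite_sample k M)).prod
      (hβ'.finite_preimage (finite_sample k M))) fun _ hp => ⟨hp.1, hp.2.1⟩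
  rw [inversions_eq_pairCount (K := fun z w => w d 0 < z d 0 ∧ ZLt z w) (inversion_sMap hg)]
  simp only [mem_sampleImage]
  have := hfin (hh i) (hh i) fun z w => w d 0 < z d 0 ∧ ZLt z w
  rw [pairCount_split (consEquiv d)]
  refine Finset.sum_eq_zero fun a _ => Finset.sum_eq_zero fun b _ => ?_
  simp only [consEquiv_apply, cons_self, consSeq]
  by_cases hba : b < a
  · simp only [hba, true_and, ZLt, firstLt_cons_of_lt hba]
    have := fun e => hfin ((hh i).cons d a) ((hh i).cons d b) fun z w =>
      rank e < rank d ∧ FirstLt e z w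
    rw [pairCount_congr (K' := fun z w => ∃ e, h.symm (cons d a z, i) ∈ sample k M ∧
      h.symm (cons d b w, i) ∈ sample k M ∧ rank e < rank d ∧ FirstLt e z w)
      (fun z w => by simp only [exists_and_left]),
      pairCount_exists fun h1 h2 => h1.2.2.2.unique h2.2.2.2]
    refine Finset.sum_eq_zero fun e _ => ?_
    by_cases he : rank e < rank d
    · simpa only [he, true_and] using hM a b e he
    · exact pairCount_false (by simp [he])
  · exact pairCount_false (by simp [hba])

/-- The sign homomorphism on a group of permutations that act on samples with an eventually
constant parity of inversions. -/
lemma exists_hom_of_inversions {G : Subgroup (Equiv.Perm (Sp n k))}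
    (hG : ∀ g ∈ G, ∃ ε : ZMod 2, ∀ h ∈ G, ∀ᶠ M in Filter.atTop,
      inversions g (sampleImage h M) = ε) :
    ∃ ρ : G →* Multiplicative (ZMod 2), ∀ (g : G) (ε : ZMod 2),
      (∀ᶠ M in Filter.atTop, inversions (g : Equiv.Perm (Sp n k)) (sampleImage 1 M) = ε) →
        ρ g = Multiplicative.ofAdd ε := by
  choose ε hε using hG
  have huniq : ∀ (g : G) (δ : ZMod 2), (∀ᶠ M in Filter.atTop,
      inversions (g : Equiv.Perm (Sp n k)) (sampleImage 1 M) = δ) → ε g g.2 = δ := by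
    intro g δ hδ
    obtain ⟨M, h1, h2⟩ := ((hε g g.2 1 G.one_mem).and hδ).exists
    exact h1.symm.trans h2
  refine ⟨MonoidHom.mk' (fun g => Multiplicative.ofAdd (ε g g.2)) fun g h => ?_,
    fun g δ hδ => congrArg Multiplicative.ofAdd (huniq g δ hδ)⟩
  rw [← ofAdd_add]
  refine congrArg _ (huniq (g * h) _ ?_)
  filter_upwards [hε g g.2 h h.2, hε h h.2 1 G.one_mem] with M h1 h2
  rw [Subgroup.coe_mul, inversions_mul, sampleImage_map, mul_one, h1, h2, add_comm]

lemma exists_inversions_eventually (hk : ∀ d, k d = 3 ∨ k d = 5)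
    (hk' : ∀ d : Fin n, (d : ℕ) ≠ 0 → k d = 5) {s : ℕ → Fin n → Equiv.Perm (Sp n k)}
    {t : ℕ → Equiv.Perm (Sp n k)} (hs : ∀ i d p, s i d p = sMap k i d p)
    (ht : ∀ i p, t i p = tMap k i p) {g : Equiv.Perm (Sp n k)}
    (hg : g ∈ Subgroup.closure (gens k s t)) :
    ∃ ε : ZMod 2, ∀ h ∈ Subgroup.closure (gens k s t), ∀ᶠ M in Filter.atTop,
      inversions g (sampleImage h M) = ε := by
  have hbrick : ∀ h ∈ Subgroup.closure (gens k s t), ∀ j,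
      PiecewiseBrick (fun z => h.symm (z, j)) := fun h hh j =>
    ((PiecewiseBrick.root j).comp_of_mem_closure hs ht hh).2
  induction hg using Subgroup.closure_induction with
  | mem g hg =>
    rcases hg with ⟨i, d, rfl⟩ | ⟨i, rfl⟩
    · exact ⟨0, fun h hh => inversions_sMap_eventually hk hk' (hs i d) (hbrick h hh)⟩
    · exact ⟨1, fun h hh => inversions_tMap_eventually hk (ht i) (hbrick h hh)⟩
  | one => exact ⟨0, fun h _ => .of_forall fun M => inversions_one _⟩
  | mul g₁ g₂ _ hg₂ ih₁ ih₂ =>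
    obtain ⟨ε₁, h₁⟩ := ih₁
    obtain ⟨ε₂, h₂⟩ := ih₂
    refine ⟨ε₂ + ε₁, fun h hh => ?_⟩
    filter_upwards [h₁ (g₂ * h) (mul_mem hg₂ hh), h₂ h hh] with M hM₁ hM₂
    rw [inversions_mul, sampleImage_map, hM₁, hM₂]
  | inv g hg ih =>
    obtain ⟨ε, hε⟩ := ih
    refine ⟨ε, fun h hh => ?_⟩
    filter_upwards [hε (g⁻¹ * h) (mul_mem (inv_mem hg) hh)] with M hM
    have := inversions_mul g g⁻¹ (sampleImage h M)
    rw [mul_inv_cancel, inversions_one, sampleImage_map, hM] at this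
    exact CharTwo.add_eq_zero.mp this.symm

end WGroup

theorem statement9 (n : ℕ) (hn : 2 ≤ n)
    (s : ℕ → Fin n → Equiv.Perm (WGroup.Sp n (kNine n)))
    (t : ℕ → Equiv.Perm (WGroup.Sp n (kNine n)))
    (hs : ∀ i d p, s i d p = WGroup.sMap (kNine n) i d p)
    (ht : ∀ i p, t i p = WGroup.tMap (kNine n) i p) :
    ∃ ρ : ↥(Subgroup.closure (WGroup.gens (kNine n) s t)) →* Multiplicative (ZMod 2),
      (∀ (i : ℕ) (d : Fin n) (h : s i d ∈ Subgroup.closure (WGroup.gens (kNine n) s t)),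
        ρ ⟨s i d, h⟩ = Multiplicative.ofAdd (0 : ZMod 2)) ∧
      (∀ (i : ℕ) (h : t i ∈ Subgroup.closure (WGroup.gens (kNine n) s t)),
        ρ ⟨t i, h⟩ = Multiplicative.ofAdd (1 : ZMod 2)) := by
  have hk : ∀ d, kNine n d = 3 ∨ kNine n d = 5 := fun d => by
    unfold kNine
    split_ifs <;> simp
  have hk' : ∀ d : Fin n, (d : ℕ) ≠ 0 → kNine n d = 5 := fun d hd => if_neg hd
  obtain ⟨ρ, hρ⟩ := WGroup.exists_hom_of_inversions
    fun _ => WGroup.exists_inversions_eventually hk hk' hs ht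
  exact ⟨ρ,
    fun i d _ => hρ _ _ (WGroup.inversions_sMap_eventually hk hk' (hs i d) .root),
    fun i _ => hρ _ _ (WGroup.inversions_tMap_eventually hk (ht i) .root)⟩
end
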